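/- arXiv:2407.17159 — 3 statements merged into one kernel-verified Lean document; each statement's English description precedes it below -/
import Mathlib

section
/- Let (f_n)_{n∈ℤ} be an M-periodic sequence in X with zero mean, i.e. f_1 + f_2 + ⋯ + f_M = 0. Then for every integer m with 1 ≤ m ≤ M and every n, ‖f_n‖ ≤ c_A · ‖f‖_0^{1−1/(2m)} · ‖D^m f‖_0^{1/(2m)}, where c_A = √(2 + √2/2). -/
noncomputable def cA : ℝ := Real.sqrt (2 + Real.sqrt 2 / 2)

/-- backward difference quotient of a bi-infinite sequence. -/
noncomputable def DqZ {X : Type*} [NormedAddCommGroup X] [NormedSpace ℝ X] (τ : ℝ) (f : ℤ → X) : ℤ → X :=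
  fun n => τ⁻¹ • (f n - f (n - 1))

/-- discrete `L²` norm `(τ Σ_{n=1}^{M} ‖f n‖²)^{1/2}` over one period. -/
noncomputable def seqNorm0Z {X : Type*} [NormedAddCommGroup X]
    (τ : ℝ) (M : ℕ) (f : ℤ → X) : ℝ :=
  Real.sqrt (τ * ∑ n ∈ Finset.Icc (1:ℤ) (M:ℤ), ‖f n‖^2)

lemma per_sum_shift {E : Type*} [AddCommGroup E] (M : ℕ) (g : ℤ → E)
    (hg : ∀ n : ℤ, g (n + M) = g n) (n : ℤ) :
    ∑ i ∈ Finset.range M, g (n + i) = ∑ i ∈ Finset.range M, g i := by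
  have step : ∀ k : ℤ, ∑ i ∈ Finset.range M, g (k + 1 + i) = ∑ i ∈ Finset.range M, g (k + i) := by
    intro k
    have h1 := Finset.sum_range_succ (fun i : ℕ => g (k + i)) M
    have h2 := Finset.sum_range_succ' (fun i : ℕ => g (k + i)) M
    rw [h1] at h2
    simp only [hg, Nat.cast_zero, add_zero] at h2
    have h3 := add_right_cancel h2
    rw [h3]
    refine Finset.sum_congr rfl fun i _ => ?_
    congr 1
    push_cast
    ring
  induction n using Int.induction_on with
  | zero => simp
  | succ k ih => rw [step, ih]
  | pred k ih =>
    rw [← ih, ← step]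
    simp

lemma icc_sum_eq {E : Type*} [AddCommGroup E] (M : ℕ) (g : ℤ → E)
    (hg : ∀ n : ℤ, g (n + M) = g n) :
    ∑ n ∈ Finset.Icc (1:ℤ) (M:ℤ), g n = ∑ i ∈ Finset.range M, g i := by
  rw [← per_sum_shift M g hg 1]
  symm
  refine Finset.sum_bij (fun (i : ℕ) _ => (1 + i : ℤ)) ?_ ?_ ?_ ?_
  · intro i hi
    simp at hi ⊢
    omega
  · intro i _ j _ h
    simpa using h
  · intro b hb
    simp at hb
    refine ⟨(b - 1).toNat, ?_, ?_⟩
    · simp; omega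
    · omega
  · intro i _
    rfl

lemma two_sided {E : Type*} [NormedAddCommGroup E] (M : ℕ) (h : ℤ → E)
    (hh : ∀ n : ℤ, h (n + M) = h n) (n : ℤ) (d : ℕ) (hd : d ≤ M) :
    2 * ‖h (n + d) - h n‖ ≤ ∑ i ∈ Finset.range M, ‖h i - h (i - 1)‖ := by
  have h1 := dist_le_range_sum_dist (fun i : ℕ => h (n + i)) d
  have h2 := dist_le_Ico_sum_dist (fun i : ℕ => h (n + i)) hd
  have h3 := Finset.sum_range_add_sum_Ico
    (fun i : ℕ => dist (h (n + i)) (h (n + ((i + 1 : ℕ) : ℤ)))) hd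
  simp only [hh, Nat.cast_zero, add_zero] at h1 h2
  rw [dist_comm] at h1
  have h4 := per_sum_shift M (fun i : ℤ => ‖h i - h (i - 1)‖)
    (by
      intro k
      have : k + M - 1 = (k - 1) + M := by ring
      simp only [this, hh]) (n + 1)
  have h5 : ∑ i ∈ Finset.range M, dist (h (n + i)) (h (n + ((i + 1 : ℕ) : ℤ)))
      = ∑ i ∈ Finset.range M, ‖h (n + 1 + i) - h (n + 1 + i - 1)‖ := by
    refine Finset.sum_congr rfl fun i _ => ?_
    rw [dist_comm, dist_eq_norm]
    congr 3
    · push_cast; ring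
    · ring
  rw [← h4, ← h5, ← h3, two_mul, ← dist_eq_norm]
  exact add_le_add h1 h2

section
variable {X : Type*} [NormedAddCommGroup X]

lemma seqNorm_eq (τ : ℝ) (M : ℕ) (f : ℤ → X) (hf : ∀ n : ℤ, f (n + M) = f n) :
    seqNorm0Z τ M f = Real.sqrt (τ * ∑ i ∈ Finset.range M, ‖f i‖^2) := by
  unfold seqNorm0Z
  rw [icc_sum_eq M (fun n => ‖f n‖^2) (by intro n; simp only [hf])]

lemma seqNorm_nonneg (τ : ℝ) (M : ℕ) (f : ℤ → X) : 0 ≤ seqNorm0Z τ M f := Real.sqrt_nonneg _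

lemma cs_shift (τ : ℝ) (hτ : 0 < τ) (M : ℕ) (f g : ℤ → X) (hf : ∀ n : ℤ, f (n + M) = f n)
    (hg : ∀ n : ℤ, g (n + M) = g n) (s : ℤ) :
    τ * ∑ i ∈ Finset.range M, ‖f (s + i)‖ * ‖g i‖ ≤ seqNorm0Z τ M f * seqNorm0Z τ M g := by
  have h1 := Real.sum_mul_le_sqrt_mul_sqrt (Finset.range M) (fun i : ℕ => ‖f (s + i)‖)
    (fun i : ℕ => ‖g i‖)
  rw [per_sum_shift M (fun n => ‖f n‖^2) (by intro n; simp only [hf])] at h1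
  rw [seqNorm_eq τ M f hf, seqNorm_eq τ M g hg, Real.sqrt_mul hτ.le, Real.sqrt_mul hτ.le]
  have := mul_le_mul_of_nonneg_left h1 hτ.le
  have h2 := Real.mul_self_sqrt hτ.le
  calc _ ≤ _ := this
    _ = _ := by
      nth_rewrite 1 [← h2]
      ring
end

section
variable {X : Type*} [NormedAddCommGroup X] [InnerProductSpace ℝ X]

lemma Dq_per (τ : ℝ) (M : ℕ) (f : ℤ → X) (hf : ∀ n : ℤ, f (n + M) = f n) :
    ∀ n : ℤ, DqZ τ f (n + M) = DqZ τ f n := by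
  intro n
  have : n + M - 1 = (n - 1) + M := by ring
  simp only [DqZ, this, hf]

lemma diff_eq (τ : ℝ) (hτ : 0 < τ) (f : ℤ → X) (n : ℤ) :
    f n - f (n - 1) = τ • DqZ τ f n := by
  simp [DqZ, smul_smul, hτ.ne']

lemma logconv (τ : ℝ) (hτ : 0 < τ) (M : ℕ) (g : ℤ → X) (hg : ∀ n : ℤ, g (n + M) = g n) :
    seqNorm0Z τ M (DqZ τ g) ^ 2 ≤ seqNorm0Z τ M g * seqNorm0Z τ M (DqZ τ (DqZ τ g)) := by
  have hD := Dq_per τ M g hg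
  have hDD := Dq_per τ M _ hD
  have hcs := cs_shift τ hτ M _ g hDD hg 1
  rw [mul_comm (seqNorm0Z τ M g)]
  refine le_trans ?_ hcs
  rw [seqNorm_eq τ M _ hD, Real.sq_sqrt (by positivity)]
  refine mul_le_mul_of_nonneg_left ?_ hτ.le
  have hs := per_sum_shift M (fun n => inner ℝ (DqZ τ g n) (g (n - 1)))
    (by
      intro k
      have : k + M - 1 = (k - 1) + M := by ring
      simp only [this, hg, hD]) 1
  have e1 : τ * ∑ i ∈ Finset.range M, ‖DqZ τ g i‖^2
      = τ * ∑ i ∈ Finset.range M, - inner ℝ (DqZ τ (DqZ τ g) (1 + i)) (g i) := by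
    have a1 : τ * ∑ i ∈ Finset.range M, ‖DqZ τ g i‖^2 =
        ∑ i ∈ Finset.range M, inner ℝ (DqZ τ g i) (g i)
        - ∑ i ∈ Finset.range M, inner ℝ (DqZ τ g i) (g (i - 1)) := by
      rw [Finset.mul_sum, ← Finset.sum_sub_distrib]
      refine Finset.sum_congr rfl fun i _ => ?_
      rw [← inner_sub_right, diff_eq τ hτ, inner_smul_right, real_inner_self_eq_norm_sq]
    rw [a1, ← hs, Finset.mul_sum, ← Finset.sum_sub_distrib]
    refine Finset.sum_congr rfl fun i _ => ?_
    have := diff_eq τ hτ (DqZ τ g) (1 + i)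
    have e : (1 + i - 1 : ℤ) = i := by ring
    rw [e] at this ⊢
    rw [← inner_sub_left, mul_neg, ← real_inner_smul_left, ← this, ← inner_neg_left, neg_sub]
  rw [mul_left_cancel₀ hτ.ne' e1]
  refine Finset.sum_le_sum fun i _ => ?_
  exact (neg_le_abs _).trans (abs_real_inner_le_norm _ _)

lemma iter_per (τ : ℝ) (M : ℕ) (f : ℤ → X) (hf : ∀ n : ℤ, f (n + M) = f n) (k : ℕ) :
    ∀ n : ℤ, (DqZ τ)^[k] f (n + M) = (DqZ τ)^[k] f n := by
  induction k with
  | zero => exact hf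
  | succ k ih => rw [Function.iterate_succ_apply']; exact Dq_per τ M _ ih

lemma interp (a : ℕ → ℝ) (h0 : ∀ k, 0 ≤ a k) (h : ∀ k, a (k+1) ^ 2 ≤ a k * a (k+2)) (k : ℕ) :
    a 1 ^ (k+1) ≤ a 0 ^ k * a (k+1) := by
  have r : ∀ k, a 1 * a k ≤ a 0 * a (k+1) := by
    intro k
    induction k with
    | zero => exact (mul_comm _ _).le
    | succ k ih =>
      rcases (h0 (k+1)).eq_or_lt with hz | hz
      · rw [← hz, mul_zero]; exact mul_nonneg (h0 _) (h0 _)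
      · refine le_of_mul_le_mul_right ?_ hz
        have := mul_le_mul_of_nonneg_left (h k) (h0 1)
        have := mul_le_mul_of_nonneg_right ih (h0 (k+2))
        show a 1 * a (k+1) * a (k+1) ≤ a 0 * a (k+2) * a (k+1)
        nlinarith
  induction k with
  | zero => simp
  | succ k ih =>
    have h1 := mul_le_mul_of_nonneg_left ih (h0 1)
    have h2 := mul_le_mul_of_nonneg_left (r (k+1)) (pow_nonneg (h0 0) k)
    calc a 1 ^ (k+1+1) = a 1 * a 1 ^ (k+1) := by ring
      _ ≤ _ := h1
      _ = a 0 ^ k * (a 1 * a (k+1)) := by ring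
      _ ≤ _ := h2
      _ = _ := by ring

lemma agmon_one (T : ℝ) (hT : 0 < T) (M : ℕ) (hM : 0 < M) (τ : ℝ) (hτ : τ = T / M)
    (f : ℤ → X) (hper : ∀ n : ℤ, f (n + M) = f n)
    (hmean : ∑ n ∈ Finset.Icc (1:ℤ) (M:ℤ), f n = 0) (n : ℤ) :
    ‖f n‖ ^ 2 ≤ 3 / 2 * (seqNorm0Z τ M f * seqNorm0Z τ M (DqZ τ f)) := by
  have hM' : (0:ℝ) < M := by exact_mod_cast hM
  have hτ0 : 0 < τ := by rw [hτ]; positivity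
  have hTM : τ * M = T := by rw [hτ]; field_simp
  have hD := Dq_per τ M f hper
  rw [icc_sum_eq M f hper] at hmean
  set A := seqNorm0Z τ M f with hA
  set B := seqNorm0Z τ M (DqZ τ f) with hB
  have hA0 : 0 ≤ A := seqNorm_nonneg _ _ _
  have hB0 : 0 ≤ B := seqNorm_nonneg _ _ _
  have hA2 : A ^ 2 = τ * ∑ i ∈ Finset.range M, ‖f i‖^2 := by
    rw [hA, seqNorm_eq τ M f hper, Real.sq_sqrt (by positivity)]
  -- squares
  have sq : ∀ k : ℤ, ∀ d : ℕ, d ≤ M → ‖f k‖^2 ≤ ‖f (k + d)‖^2 + A * B := by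
    intro k d hd
    have h1 := two_sided M (fun j => ‖f j‖^2) (by intro j; simp only [hper]) k d hd
    have h2 : ∑ i ∈ Finset.range M, ‖‖f i‖^2 - ‖f (i - 1)‖^2‖
        ≤ τ * ∑ i ∈ Finset.range M, ‖f (0 + i)‖ * ‖DqZ τ f i‖
          + τ * ∑ i ∈ Finset.range M, ‖f (-1 + i)‖ * ‖DqZ τ f i‖ := by
      rw [← mul_add, ← Finset.sum_add_distrib, Finset.mul_sum]
      refine Finset.sum_le_sum fun i _ => ?_
      have e1 : (-1 + i : ℤ) = i - 1 := by ring
      rw [e1, zero_add]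
      have e2 : ‖f i‖^2 - ‖f (i - 1)‖^2 = (‖f i‖ + ‖f (i-1)‖) * (‖f i‖ - ‖f (i-1)‖) := by ring
      have e3 := abs_norm_sub_norm_le (f i) (f (i-1))
      rw [diff_eq τ hτ0, norm_smul, Real.norm_of_nonneg hτ0.le] at e3
      rw [e2, norm_mul, Real.norm_of_nonneg (by positivity), Real.norm_eq_abs]
      calc _ ≤ (‖f i‖ + ‖f (i-1)‖) * (τ * ‖DqZ τ f i‖) :=
            mul_le_mul_of_nonneg_left e3 (by positivity)
        _ = _ := by ring
    have h3 := cs_shift τ hτ0 M f _ hper hD 0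
    have h4 := cs_shift τ hτ0 M f _ hper hD (-1)
    have h5 := neg_abs_le (‖f (k + d)‖^2 - ‖f k‖^2)
    rw [Real.norm_eq_abs] at h1
    linarith
  -- first differences
  have fst : ∀ k : ℤ, ∀ d : ℕ, d ≤ M → 2 * ‖f (k + d) - f k‖ ≤ Real.sqrt T * B := by
    intro k d hd
    refine (two_sided M f hper k d hd).trans ?_
    have h3 := cs_shift τ hτ0 M (fun _ => (1:ℝ)) (fun i => ‖DqZ τ f i‖) (by simp)
      (by intro j; simp only [hD]) 0
    have e1 : seqNorm0Z τ M (fun _ => (1:ℝ)) = Real.sqrt T := by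
      rw [seqNorm_eq _ _ _ (by simp)]; simp [hTM]
    have e2 : seqNorm0Z τ M (fun i => ‖DqZ τ f i‖) = B := by
      simp [seqNorm0Z, hB]
    rw [e1, e2] at h3
    refine le_trans (le_of_eq ?_) h3
    rw [Finset.mul_sum]
    refine Finset.sum_congr rfl fun i _ => ?_
    rw [diff_eq τ hτ0, norm_smul, Real.norm_of_nonneg hτ0.le]
    simp
  have ptw : ∀ k : ℤ, 2 * ‖f k‖ ≤ Real.sqrt T * B := by
    intro k
    have h1 : ∑ i ∈ Finset.range M, (f (k + i) - f k) = - ((M:ℝ) • f k) := by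
      rw [Finset.sum_sub_distrib, per_sum_shift M f hper, hmean]
      simp [Nat.cast_smul_eq_nsmul]
    have h2 := norm_sum_le (Finset.range M) (fun i : ℕ => f (k + i) - f k)
    rw [h1, norm_neg, norm_smul, Real.norm_of_nonneg hM'.le] at h2
    have h3 : ∑ i ∈ Finset.range M, ‖f (k + i) - f k‖
        ≤ ∑ i ∈ Finset.range M, (Real.sqrt T * B / 2) :=
      Finset.sum_le_sum fun i hi => by
        have := fst k i (Finset.mem_range.1 hi).le
        linarith
    rw [Finset.sum_const, Finset.card_range, nsmul_eq_mul] at h3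
    have := le_of_mul_le_mul_left (h2.trans h3) hM'
    linarith
  have poin : 2 * A ≤ T * B := by
    have h1 : A ^ 2 ≤ (T * B / 2) ^ 2 := by
      rw [hA2]
      have : ∑ i ∈ Finset.range M, ‖f i‖^2 ≤ ∑ i ∈ Finset.range M, T * B^2 / 4 := by
        refine Finset.sum_le_sum fun i _ => ?_
        have h := ptw i
        have h' : ‖f i‖^2 ≤ (Real.sqrt T * B / 2)^2 := by
          refine pow_le_pow_left₀ (norm_nonneg _) ?_ 2
          linarith
        have hs := Real.sq_sqrt hT.le
        calc _ ≤ _ := h'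
          _ = Real.sqrt T ^ 2 * B^2 / 4 := by ring
          _ = _ := by rw [hs]
      rw [Finset.sum_const, Finset.card_range, nsmul_eq_mul] at this
      calc _ ≤ _ := mul_le_mul_of_nonneg_left this hτ0.le
        _ = (τ * M) * T * B^2 / 4 := by ring
        _ = _ := by rw [hTM]; ring
    have := abs_le_of_sq_le_sq h1 (by positivity)
    linarith [le_abs_self A]
  have avg : M * ‖f n‖^2 ≤ ∑ i ∈ Finset.range M, ‖f i‖^2 + M * (A * B) := by
    have h1 : ∑ i ∈ Finset.range M, ‖f n‖^2 ≤ ∑ i ∈ Finset.range M, (‖f (n + i)‖^2 + A * B) :=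
      Finset.sum_le_sum fun i hi => sq n i (Finset.mem_range.1 hi).le
    rw [Finset.sum_add_distrib, per_sum_shift M (fun n => ‖f n‖^2) (by intro n; simp only [hper]),
      Finset.sum_const, Finset.sum_const, Finset.card_range, nsmul_eq_mul, nsmul_eq_mul] at h1
    exact h1
  have avg2 : T * ‖f n‖^2 ≤ A ^ 2 + T * (A * B) := by
    have := mul_le_mul_of_nonneg_left avg hτ0.le
    rw [mul_add, ← hA2, ← mul_assoc, ← mul_assoc, hTM] at this
    exact this
  have h6 : A ^ 2 ≤ T * B * A / 2 := by nlinarith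
  refine le_of_mul_le_mul_left ?_ hT
  linarith
end

/-- Lemma 4.4: discrete Agmon-type maximum bound for zero-mean M-periodic sequences:
`‖f_n‖ ≤ c_A ‖f‖₀^{1−1/(2m)} ‖Dᵐf‖₀^{1/(2m)}` for `1 ≤ m ≤ M`. -/
theorem periodic_agmon_max
    {X : Type*} [NormedAddCommGroup X] [InnerProductSpace ℝ X] [CompleteSpace X]
    (T : ℝ) (hT : 0 < T) (M : ℕ) (hM : 0 < M) (τ : ℝ) (hτ : τ = T / M)
    (f : ℤ → X) (hper : ∀ n : ℤ, f (n + M) = f n)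
    (hmean : ∑ n ∈ Finset.Icc (1:ℤ) (M:ℤ), f n = 0)
    (m : ℕ) (hm : 1 ≤ m) (hmM : m ≤ M) (n : ℤ) :
    ‖f n‖ ≤ cA * (seqNorm0Z τ M f) ^ (1 - 1/(2*(m:ℝ))) *
      (seqNorm0Z τ M ((DqZ τ)^[m] f)) ^ (1/(2*(m:ℝ))) := by
  set N := fun k : ℕ => seqNorm0Z τ M ((DqZ τ)^[k] f) with hN
  have hM' : (0:ℝ) < M := by exact_mod_cast hM
  have hτ0 : 0 < τ := by rw [hτ]; positivity
  have hN0 : ∀ k, 0 ≤ N k := fun k => seqNorm_nonneg _ _ _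
  have hlc : ∀ k, N (k+1) ^ 2 ≤ N k * N (k+2) := by
    intro k
    have := logconv τ hτ0 M _ (iter_per τ M f hper k)
    simpa only [hN, Function.iterate_succ_apply'] using this
  obtain ⟨k, rfl⟩ : ∃ k, m = k + 1 := ⟨m - 1, by omega⟩
  have hi := interp N hN0 hlc k
  have h1 : ‖f n‖ ^ 2 ≤ 3 / 2 * (N 0 * N 1) := agmon_one T hT M hM τ hτ f hper hmean n
  have hc : 3 / 2 ≤ cA ^ 2 := by
    unfold cA
    rw [Real.sq_sqrt (by positivity)]
    linarith [Real.sqrt_nonneg 2]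
  have hc0 : 0 ≤ cA := Real.sqrt_nonneg _
  change ‖f n‖ ≤ cA * (N 0) ^ (1 - 1/(2*((k+1 : ℕ):ℝ))) * (N (k+1)) ^ (1/(2*((k+1 : ℕ):ℝ)))
  have p0 := hN0 0
  have p1 := hN0 1
  have pk := hN0 (k+1)
  refine le_of_pow_le_pow_left₀ (n := 2 * (k+1)) (by omega) (by positivity) ?_
  have e1 : ((N 0) ^ (1 - 1/(2*((k+1 : ℕ):ℝ)))) ^ (2 * (k+1)) = N 0 ^ (2 * k + 1) := by
    rw [← Real.rpow_natCast, ← Real.rpow_mul p0, ← Real.rpow_natCast]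
    congr 1
    push_cast
    field_simp
    ring
  have e2 : ((N (k+1)) ^ (1/(2*((k+1 : ℕ):ℝ)))) ^ (2 * (k+1)) = N (k+1) := by
    rw [← Real.rpow_natCast, ← Real.rpow_mul pk]
    conv_rhs => rw [← Real.rpow_one (N (k+1))]
    congr 1
    push_cast
    field_simp
  rw [mul_pow, mul_pow, e1, e2, pow_mul, pow_mul]
  calc (‖f n‖ ^ 2) ^ (k+1) ≤ (cA ^ 2 * (N 0 * N 1)) ^ (k+1) := by
        refine pow_le_pow_left₀ (by positivity) (h1.trans ?_) _
        exact mul_le_mul_of_nonneg_right hc (by positivity)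
    _ = (cA ^ 2) ^ (k+1) * N 0 ^ (k+1) * N 1 ^ (k+1) := by ring
    _ ≤ (cA ^ 2) ^ (k+1) * N 0 ^ (k+1) * (N 0 ^ k * N (k+1)) :=
        mul_le_mul_of_nonneg_left hi (by positivity)
    _ = _ := by ring
end

section
/- Let f = (f_n)_{n=0}^M be a sequence in X with f_0 + f_1 + ⋯ + f_M = 0. Then for every integer m with 2 ≤ m ≤ M, ‖D^1 f‖_0 ≤ c_m · ‖f‖_0^{(m−1)/m} · ‖D^1 f‖_{m−1}^{1/m}. -/
noncomputable def cA1 : ℝ := (1 + (Real.sqrt 2 * cA) ^ ((4:ℝ)/3)) ^ ((3:ℝ)/4)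
noncomputable def cB1 : ℝ := 2 * Real.sqrt (1 + 2 * (cA * cA1)^2)

/-- `dAux j = (d̂_j, ∏_{i≤j} d̂_i^{1/(i+1)})`, realizing the recursion (4.20). -/
noncomputable def dAux : ℕ → ℝ × ℝ
  | 0 => (cB1, cB1)
  | (j+1) =>
      let d : ℝ := (1 + (dAux j).1 ^ (2*((j:ℝ)+2))) ^ (((j:ℝ)+2) / (2*((j:ℝ)+1)*((j:ℝ)+3))) *
                   ((dAux j).2) ^ (((j:ℝ)+2) / (((j:ℝ)+1)*((j:ℝ)+3)))
      (d, (dAux j).2 * d ^ (1/((j:ℝ)+2)))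

noncomputable def dHat (j : ℕ) : ℝ := (dAux j).1

/-- `cAux j = (ĉ_j, ∏_{i≤j} ĉ_i^{1/(i+1)})`, realizing the recursion (4.19). -/
noncomputable def cAux : ℕ → ℝ × ℝ
  | 0 => (cB1 / Real.sqrt 2, cB1 / Real.sqrt 2)
  | (j+1) =>
      let c : ℝ := (1 + dHat j ^ (2*((j:ℝ)+2))) ^ (((j:ℝ)+2) / (2*((j:ℝ)+1)*((j:ℝ)+3))) *
                   ((cAux j).2) ^ (((j:ℝ)+2) / (((j:ℝ)+1)*((j:ℝ)+3)))
      (c, (cAux j).2 * c ^ (1/((j:ℝ)+2)))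

noncomputable def cHat (j : ℕ) : ℝ := (cAux j).1

/-- the constant `c_m = ∏_{j=0}^{m-2} ĉ_j^{1/(j+1)}` (equal to `1` for `m = 1`). -/
noncomputable def cConst (m : ℕ) : ℝ := ∏ j ∈ Finset.range (m-1), cHat j ^ (1/((j:ℝ)+1))

/-- backward difference quotient of a sequence. -/
noncomputable def Dq {X : Type*} [NormedAddCommGroup X] [NormedSpace ℝ X] (τ : ℝ) (f : ℕ → X) : ℕ → X :=
  fun n => τ⁻¹ • (f n - f (n - 1))

/-- discrete `L²` norm `(τ Σ_{n=a}^{b} ‖f n‖²)^{1/2}`. -/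
noncomputable def seqNorm0 {X : Type*} [NormedAddCommGroup X]
    (τ : ℝ) (a b : ℕ) (f : ℕ → X) : ℝ :=
  Real.sqrt (τ * ∑ n ∈ Finset.Icc a b, ‖f n‖^2)

/-- `T_0 = T` and `T_j = (M+1−j)τ` for `j ≥ 1`. -/
noncomputable def Tk (τ T : ℝ) (M j : ℕ) : ℝ := if j = 0 then T else ((M:ℝ) + 1 - (j:ℝ)) * τ

/-- the scale-invariant norm `‖Dᵏf‖_m = (Σ_{j=k}^{k+m} T_j^{−2(m+k−j)} ‖Dʲf‖₀²)^{1/2}`. -/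
noncomputable def normm {X : Type*} [NormedAddCommGroup X] [NormedSpace ℝ X]
    (τ T : ℝ) (M k m : ℕ) (f : ℕ → X) : ℝ :=
  Real.sqrt (∑ j ∈ Finset.Icc k (k+m),
    (seqNorm0 τ j M ((Dq τ)^[j] f))^2 / (Tk τ T M j)^(2*(m+k-j)))

section aux
variable {X : Type*} [NormedAddCommGroup X] [InnerProductSpace ℝ X]

lemma aux_sq_diff (h : ℕ → X) (n i l : ℕ) (hi : i ≤ n) (hl : l ≤ n) :
    ‖h i‖^2 - ‖h l‖^2 ≤ 2 * Real.sqrt (∑ j ∈ Finset.range (n+1), ‖h j‖^2) *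
      Real.sqrt (∑ j ∈ Finset.range n, ‖h (j+1) - h j‖^2) := by
  set S := ∑ j ∈ Finset.range (n+1), ‖h j‖^2 with hS
  set E := ∑ j ∈ Finset.range n, ‖h (j+1) - h j‖^2 with hE
  have h1 : ∀ a b : ℕ, a ≤ b → b ≤ n → dist (‖h a‖^2) (‖h b‖^2) ≤
      ∑ j ∈ Finset.range n, dist (‖h j‖^2) (‖h (j+1)‖^2) := by
    intro a b hab hb
    refine (dist_le_Ico_sum_dist (fun j => ‖h j‖^2) hab).trans ?_
    apply Finset.sum_le_sum_of_subset_of_nonneg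
    · intro j hj
      simp only [Finset.mem_Ico, Finset.mem_range] at *
      omega
    · intros; exact dist_nonneg
  have h2 : dist (‖h i‖^2) (‖h l‖^2) ≤
      ∑ j ∈ Finset.range n, dist (‖h j‖^2) (‖h (j+1)‖^2) := by
    rcases le_total i l with h | h
    · exact h1 i l h hl
    · rw [dist_comm]; exact h1 l i h hi
  have h3 : ∑ j ∈ Finset.range n, dist (‖h j‖^2) (‖h (j+1)‖^2) ≤
      ∑ j ∈ Finset.range n, ‖h (j+1) - h j‖ * ‖h (j+1)‖ +
      ∑ j ∈ Finset.range n, ‖h (j+1) - h j‖ * ‖h j‖ := by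
    rw [← Finset.sum_add_distrib]
    apply Finset.sum_le_sum
    intro j _
    have e1 := abs_norm_sub_norm_le (h j) (h (j+1))
    rw [Real.dist_eq, ← mul_add, sq_sub_sq, abs_mul, abs_of_nonneg (by positivity), mul_comm,
      norm_sub_rev (h (j+1)), add_comm ‖h j‖]
    gcongr
  have h4 := Real.sum_mul_le_sqrt_mul_sqrt (Finset.range n) (fun j => ‖h (j+1) - h j‖)
    (fun j => ‖h (j+1)‖)
  have h5 := Real.sum_mul_le_sqrt_mul_sqrt (Finset.range n) (fun j => ‖h (j+1) - h j‖)
    (fun j => ‖h j‖)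
  have h6 : Real.sqrt (∑ j ∈ Finset.range n, ‖h (j+1)‖^2) ≤ Real.sqrt S := by
    apply Real.sqrt_le_sqrt
    rw [hS, Finset.sum_range_succ']
    nlinarith [sq_nonneg ‖h 0‖]
  have h7 : Real.sqrt (∑ j ∈ Finset.range n, ‖h j‖^2) ≤ Real.sqrt S := by
    apply Real.sqrt_le_sqrt
    rw [hS, Finset.sum_range_succ]
    nlinarith [sq_nonneg ‖h n‖]
  have h8 := le_abs_self (‖h i‖^2 - ‖h l‖^2)
  rw [← Real.dist_eq] at h8
  have h9 := mul_le_mul_of_nonneg_left h6 (Real.sqrt_nonneg E)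
  have h10 := mul_le_mul_of_nonneg_left h7 (Real.sqrt_nonneg E)
  simp only [← hE] at h4 h5
  linarith

lemma aux_max (h : ℕ → X) (n i : ℕ) (hi : i ≤ n) :
    ‖h i‖^2 ≤ (∑ j ∈ Finset.range (n+1), ‖h j‖^2) / ((n:ℝ)+1) +
      2 * Real.sqrt (∑ j ∈ Finset.range (n+1), ‖h j‖^2) *
      Real.sqrt (∑ j ∈ Finset.range n, ‖h (j+1) - h j‖^2) := by
  set Q := 2 * Real.sqrt (∑ j ∈ Finset.range (n+1), ‖h j‖^2) *
      Real.sqrt (∑ j ∈ Finset.range n, ‖h (j+1) - h j‖^2) with hQ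
  have h1 : ∑ l ∈ Finset.range (n+1), (‖h i‖^2 - Q) ≤ ∑ l ∈ Finset.range (n+1), ‖h l‖^2 := by
    apply Finset.sum_le_sum
    intro l hl
    have := aux_sq_diff h n i l hi (by simpa [Nat.lt_succ_iff] using hl)
    linarith
  rw [Finset.sum_const, Finset.card_range, nsmul_eq_mul] at h1
  push_cast at h1
  have h2 : ‖h i‖^2 - Q ≤ (∑ j ∈ Finset.range (n+1), ‖h j‖^2) / ((n:ℝ)+1) := by
    rw [le_div_iff₀ (by positivity)]
    linarith
  linarith

lemma aux_parts (g : ℕ → X) (L : ℕ) :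
    ∑ n ∈ Finset.range (L+1), ‖g (n+1) - g n‖^2 =
      inner ℝ (g (L+1) - g L) (g (L+1)) - inner ℝ (g 1 - g 0) (g 0)
      - ∑ n ∈ Finset.range L, inner ℝ ((g (n+2) - g (n+1)) - (g (n+1) - g n)) (g (n+1)) := by
  induction L with
  | zero =>
    simp only [zero_add, Finset.sum_range_one, Finset.sum_range_zero, sub_zero]
    rw [← inner_sub_right, real_inner_self_eq_norm_sq]
  | succ L ih =>
    rw [Finset.sum_range_succ, ih, Finset.sum_range_succ _ L, ← real_inner_self_eq_norm_sq]
    simp only [inner_sub_left, inner_sub_right]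
    rw [show L + 1 + 1 = L + 2 from rfl, real_inner_comm (g (L+2)) (g (L+1))]
    ring

lemma aux_real (P G E H a b : ℝ) (hG : 0 ≤ G) 
    (hH : 0 ≤ H) (hEH : E ≤ H) (h1 : P^2 ≤ G*E + 2*(a*b))
    (ha : a^2 ≤ P * (3*H)) (hb : b^2 ≤ 3*G*P) : P^2 ≤ 40 * (G*H) := by
  by_contra hcon
  push Not at hcon
  have hy : 0 ≤ G*H := mul_nonneg hG hH
  have hGE : G*E ≤ G*H := by gcongr
  have hab : (a*b)^2 ≤ 9*(G*H)*P^2 := by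
    rw [mul_pow]
    calc a^2*b^2 ≤ (P*(3*H))*(3*G*P) := mul_le_mul ha hb (sq_nonneg _) ((sq_nonneg _).trans ha)
      _ = _ := by ring
  generalize G*H = y at *
  generalize P^2 = q at *
  have h2 : 0 ≤ q - y := by linarith
  have h3 : q - y ≤ 2*(a*b) := by linarith
  have h4 : (q-y)^2 ≤ (2*(a*b))^2 := by gcongr
  nlinarith

lemma aux_core (g : ℕ → X) (L : ℕ) :
    (∑ n ∈ Finset.range (L+1), ‖g (n+1) - g n‖^2) ≤
    40 * (Real.sqrt (∑ n ∈ Finset.range (L+2), ‖g n‖^2) *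
      Real.sqrt ((∑ n ∈ Finset.range (L+1), ‖g (n+1) - g n‖^2) / ((L:ℝ)+1)^2 +
        ∑ n ∈ Finset.range L, ‖(g (n+2) - g (n+1)) - (g (n+1) - g n)‖^2)) := by
  have m1 := aux_max g (L+1)
  have m2 := aux_max (fun n => g (n+1) - g n) L
  have hp := aux_parts g L
  have hcs : -∑ n ∈ Finset.range L, inner ℝ ((g (n+2) - g (n+1)) - (g (n+1) - g n)) (g (n+1)) ≤
      Real.sqrt (∑ n ∈ Finset.range (L+2), ‖g n‖^2) *
      Real.sqrt (∑ n ∈ Finset.range L, ‖(g (n+2) - g (n+1)) - (g (n+1) - g n)‖^2) := by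
    rw [← Finset.sum_neg_distrib]
    calc _ ≤ ∑ n ∈ Finset.range L, ‖g (n+1)‖ * ‖(g (n+2) - g (n+1)) - (g (n+1) - g n)‖ := by
          apply Finset.sum_le_sum
          intro n _
          have := abs_real_inner_le_norm ((g (n+2) - g (n+1)) - (g (n+1) - g n)) (g (n+1))
          rw [mul_comm]
          exact (neg_le_abs _).trans this
      _ ≤ _ := Real.sum_mul_le_sqrt_mul_sqrt _ _ _
      _ ≤ _ := by
          gcongr ?_ * _
          apply Real.sqrt_le_sqrt
          rw [Finset.sum_range_succ, Finset.sum_range_succ']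
          nlinarith [sq_nonneg ‖g 0‖, sq_nonneg ‖g (L+1)‖]
  have m1a := m1 0 (by omega)
  have m1b := m1 (L+1) le_rfl
  have m2a := m2 0 (by omega)
  have m2b := m2 L le_rfl
  simp only [zero_add] at m2a
  have G0 : 0 ≤ ∑ n ∈ Finset.range (L+2), ‖g n‖^2 := by positivity
  have P0 : 0 ≤ ∑ n ∈ Finset.range (L+1), ‖g (n+1) - g n‖^2 := by positivity
  have E0 : 0 ≤ ∑ n ∈ Finset.range L, ‖(g (n+2) - g (n+1)) - (g (n+1) - g n)‖^2 := by positivity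
  simp only [show ∀ n, n + 1 + 1 = n + 2 from fun _ => rfl] at *
  have i1 := real_inner_le_norm (g (L+1) - g L) (g (L+1))
  have i2 := (neg_le_abs _).trans (abs_real_inner_le_norm (g 1 - g 0) (g 0))
  push_cast at m1a m1b
  generalize (∑ n ∈ Finset.range (L+2), ‖g n‖^2) = G2 at *
  generalize (∑ n ∈ Finset.range (L+1), ‖g (n+1) - g n‖^2) = P2 at *
  generalize (∑ n ∈ Finset.range L, ‖(g (n+2) - g (n+1)) - (g (n+1) - g n)‖^2) = E2 at *
  clear m1 m2
  obtain ⟨G, hG, rfl⟩ : ∃ G, 0 ≤ G ∧ G2 = G^2 := ⟨Real.sqrt G2, Real.sqrt_nonneg _, (Real.sq_sqrt G0).symm⟩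
  obtain ⟨P, hP, rfl⟩ : ∃ G, 0 ≤ G ∧ P2 = G^2 := ⟨Real.sqrt P2, Real.sqrt_nonneg _, (Real.sq_sqrt P0).symm⟩
  obtain ⟨E, hE, rfl⟩ : ∃ G, 0 ≤ G ∧ E2 = G^2 := ⟨Real.sqrt E2, Real.sqrt_nonneg _, (Real.sq_sqrt E0).symm⟩
  simp only [Real.sqrt_sq hG, Real.sqrt_sq hP, Real.sqrt_sq hE] at *
  set H := Real.sqrt (P^2/((L:ℝ)+1)^2 + E^2) with hH
  have hL : (0:ℝ) < (L:ℝ)+1 := by positivity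
  have hH0 : 0 ≤ H := Real.sqrt_nonneg _
  have hEH : E ≤ H := Real.le_sqrt_of_sq_le (by have : 0 ≤ P^2/((L:ℝ)+1)^2 := by positivity
                                                linarith)
  have hPH : P/((L:ℝ)+1) ≤ H := Real.le_sqrt_of_sq_le (by rw [div_pow]; nlinarith)
  rcases le_total (((L:ℝ)+1)*P) G with hc | hc
  · have : P^2 ≤ G * H := by
      calc P^2 = (((L:ℝ)+1)*P) * (P/((L:ℝ)+1)) := by field_simp
        _ ≤ G * H := mul_le_mul hc hPH (by positivity) hG
    nlinarith [mul_nonneg hG hH0]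
  · have hb : G^2/((L:ℝ)+1+1) + 2*G*P ≤ 3*G*P := by
      have : G^2/((L:ℝ)+1+1) ≤ G*P := by
        rw [div_le_iff₀ (by positivity)]
        nlinarith [mul_nonneg hG hP, mul_le_mul_of_nonneg_left hc hG]
      linarith
    have ha : P^2/((L:ℝ)+1) + 2*P*E ≤ P*(3*H) := by
      have : P^2/((L:ℝ)+1) = P * (P/((L:ℝ)+1)) := by ring
      rw [this]
      nlinarith [mul_le_mul_of_nonneg_left hPH hP, mul_le_mul_of_nonneg_left hEH hP]
    have q1 : 0 ≤ P*(3*H) := by positivity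
    have q2 : 0 ≤ 3*G*P := by positivity
    refine aux_real P G E H (Real.sqrt (P*(3*H))) (Real.sqrt (3*G*P)) hG hH0 hEH ?_
      (Real.sq_sqrt q1).le (Real.sq_sqrt q2).le
    have n1 : ‖g (L+1) - g L‖ ≤ Real.sqrt (P*(3*H)) := Real.le_sqrt_of_sq_le (by linarith)
    have n2 : ‖g 1 - g 0‖ ≤ Real.sqrt (P*(3*H)) := Real.le_sqrt_of_sq_le (by linarith)
    have n3 : ‖g (L+1)‖ ≤ Real.sqrt (3*G*P) := Real.le_sqrt_of_sq_le (by linarith)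
    have n4 : ‖g 0‖ ≤ Real.sqrt (3*G*P) := Real.le_sqrt_of_sq_le (by linarith)
    have n5 := mul_le_mul n1 n3 (norm_nonneg _) (Real.sqrt_nonneg _)
    have n6 := mul_le_mul n2 n4 (norm_nonneg _) (Real.sqrt_nonneg _)
    linarith

lemma aux_step (τ : ℝ) (hτ : 0 < τ) (u : ℕ → X) (k L : ℕ) :
    (seqNorm0 τ (k+1) (k+L+1) (Dq τ u))^2 ≤ 40 * (seqNorm0 τ k (k+L+1) u *
      Real.sqrt ((seqNorm0 τ (k+1) (k+L+1) (Dq τ u))^2 / (((L:ℝ)+1)*τ)^2 +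
        (seqNorm0 τ (k+2) (k+L+1) (Dq τ (Dq τ u)))^2)) := by
  have hc := aux_core (fun n => u (k+n)) L
  have s0 : ∀ (a n : ℕ) (v : ℕ → ℝ), ∑ j ∈ Finset.Icc a (a+n), v j = ∑ j ∈ Finset.range (n+1), v (a+j) := by
    intro a n v
    rw [← Finset.Ico_add_one_right_eq_Icc, Finset.sum_Ico_eq_sum_range]
    congr 2
    omega
  have e0 : ∑ n ∈ Finset.Icc k (k+L+1), ‖u n‖^2 = ∑ n ∈ Finset.range (L+2), ‖u (k+n)‖^2 :=
    s0 k (L+1) _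
  have e1 : ∑ n ∈ Finset.Icc (k+1) (k+L+1), ‖Dq τ u n‖^2 =
      τ⁻¹^2 * ∑ n ∈ Finset.range (L+1), ‖u (k+(n+1)) - u (k+n)‖^2 := by
    rw [show k+L+1 = k+1+L by omega, s0, Finset.mul_sum]
    apply Finset.sum_congr rfl
    intro n _
    rw [Dq, norm_smul, mul_pow, show k+1+n-1 = k+n by omega, show k+1+n = k+(n+1) by omega]
    simp
  have e2 : ∑ n ∈ Finset.Icc (k+2) (k+L+1), ‖Dq τ (Dq τ u) n‖^2 =
      τ⁻¹^4 * ∑ n ∈ Finset.range L,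
        ‖(u (k+(n+2)) - u (k+(n+1))) - (u (k+(n+1)) - u (k+n))‖^2 := by
    rw [← Finset.Ico_add_one_right_eq_Icc, Finset.sum_Ico_eq_sum_range,
      show k+L+1+1-(k+2) = L by omega, Finset.mul_sum]
    apply Finset.sum_congr rfl
    intro n _
    rw [Dq, Dq, Dq, ← smul_sub, smul_smul, norm_smul, mul_pow, show k+2+n-1-1 = k+n by omega,
      show k+2+n-1 = k+(n+1) by omega, show k+2+n = k+(n+2) by omega]
    simp only [norm_mul, norm_inv, Real.norm_eq_abs, abs_of_pos hτ]
    ring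
  unfold seqNorm0
  rw [e0, e1, e2]
  have G0 : 0 ≤ ∑ n ∈ Finset.range (L+2), ‖u (k+n)‖^2 := by positivity
  have P0 : 0 ≤ ∑ n ∈ Finset.range (L+1), ‖u (k+(n+1)) - u (k+n)‖^2 := by positivity
  have E0 : 0 ≤ ∑ n ∈ Finset.range L,
        ‖(u (k+(n+2)) - u (k+(n+1))) - (u (k+(n+1)) - u (k+n))‖^2 := by positivity
  generalize (∑ n ∈ Finset.range (L+2), ‖u (k+n)‖^2) = G2 at *
  generalize (∑ n ∈ Finset.range (L+1), ‖u (k+(n+1)) - u (k+n)‖^2) = P2 at *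
  generalize (∑ n ∈ Finset.range L,
        ‖(u (k+(n+2)) - u (k+(n+1))) - (u (k+(n+1)) - u (k+n))‖^2) = E2 at *
  rw [Real.sq_sqrt (by positivity), Real.sq_sqrt (by positivity)]
  rw [← Real.sqrt_mul G0] at hc
  rw [← Real.sqrt_mul (by positivity)]
  have : τ * G2 * (τ * (τ⁻¹^2 * P2) / (((L:ℝ)+1)*τ)^2 + τ * (τ⁻¹^4*E2)) =
      (τ⁻¹)^2 * (G2 * (P2/((L:ℝ)+1)^2 + E2)) := by
    field_simp
  rw [this, Real.sqrt_mul (by positivity), Real.sqrt_sq (by positivity)]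
  calc τ * (τ⁻¹^2*P2) = τ⁻¹ * P2 := by field_simp
    _ ≤ τ⁻¹ * _ := mul_le_mul_of_nonneg_left hc (by positivity)
    _ = _ := by ring

end aux

lemma aux_cB1 : 80 ≤ cB1^2 := by
  have hA : cA^2 = 2 + Real.sqrt 2 / 2 := by unfold cA; rw [Real.sq_sqrt (by positivity)]
  have hA0 : 0 ≤ cA := Real.sqrt_nonneg _
  have h2 : 1 ≤ Real.sqrt 2 := Real.one_le_sqrt.2 (by norm_num)
  have h22 : Real.sqrt 2 ^ 2 = 2 := Real.sq_sqrt (by norm_num)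
  have hx : 2 ≤ Real.sqrt 2 * cA := by
    apply le_of_sq_le_sq _ (by positivity)
    rw [mul_pow, hA, h22]; linarith
  have hy : (2:ℝ) ≤ (Real.sqrt 2 * cA) ^ ((4:ℝ)/3) :=
    calc (2:ℝ) ≤ Real.sqrt 2 * cA := hx
      _ = (Real.sqrt 2 * cA) ^ (1:ℝ) := (Real.rpow_one _).symm
      _ ≤ _ := Real.rpow_le_rpow_of_exponent_le (by linarith) (by norm_num)
  have h1 : 2 ≤ cA1 := by
    unfold cA1
    calc (2:ℝ) = (2^(4:ℝ))^((1:ℝ)/4) := by rw [← Real.rpow_mul (by norm_num)]; norm_num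
      _ ≤ (3^(3:ℝ))^((1:ℝ)/4) := by gcongr; norm_num
      _ = 3^((3:ℝ)/4) := by rw [← Real.rpow_mul (by norm_num)]; norm_num
      _ ≤ _ := by gcongr; linarith
  unfold cB1
  rw [mul_pow, Real.sq_sqrt (by positivity), mul_pow, hA]
  nlinarith [mul_self_le_mul_self (by norm_num) h1]

lemma aux_cB1_pos : 0 < cB1 := by unfold cB1; positivity

lemma aux_log_d (j : ℕ) : 0 < (dAux j).1 ∧ 0 < (dAux j).2 ∧
    ((j:ℝ)+1) * Real.log cB1 ≤ Real.log (dAux j).1 ∧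
    ((j:ℝ)+1) * Real.log cB1 ≤ Real.log (dAux j).2 := by
  induction j with
  | zero => simp [dAux, aux_cB1_pos]
  | succ j ih =>
    obtain ⟨p1, p2, l1, l2⟩ := ih
    have q1 : 0 < (dAux (j+1)).1 := by
      simp only [dAux]; positivity
    have k1 : ((j:ℝ)+2) * Real.log cB1 ≤ Real.log (dAux (j+1)).1 := by
      simp only [dAux]
      rw [Real.log_mul (by positivity) (by positivity), Real.log_rpow (by positivity),
        Real.log_rpow p2]
      have a1 : 2*((j:ℝ)+2) * (((j:ℝ)+1) * Real.log cB1) ≤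
          Real.log (1 + (dAux j).1 ^ (2*((j:ℝ)+2))) := by
        calc _ ≤ 2*((j:ℝ)+2) * Real.log (dAux j).1 := by gcongr
          _ = Real.log ((dAux j).1 ^ (2*((j:ℝ)+2))) := (Real.log_rpow p1 _).symm
          _ ≤ _ := Real.log_le_log (by positivity) (by linarith)
      calc _ = ((j:ℝ)+2) / (2*((j:ℝ)+1)*((j:ℝ)+3)) * (2*((j:ℝ)+2) * (((j:ℝ)+1) * Real.log cB1))
            + ((j:ℝ)+2) / (((j:ℝ)+1)*((j:ℝ)+3)) * (((j:ℝ)+1) * Real.log cB1) := by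
              field_simp; ring
        _ ≤ _ := by gcongr
    refine ⟨q1, ?_, ?_, ?_⟩
    · show 0 < (dAux j).2 * (dAux (j+1)).1 ^ _
      positivity
    · push_cast; linarith
    · show _ ≤ Real.log ((dAux j).2 * (dAux (j+1)).1 ^ (1/((j:ℝ)+2)))
      rw [Real.log_mul (by positivity) (by positivity), Real.log_rpow q1]
      push_cast
      calc _ = ((j:ℝ)+1) * Real.log cB1 + (1/((j:ℝ)+2)) * (((j:ℝ)+2) * Real.log cB1) := by
            field_simp
        _ ≤ _ := by gcongr

lemma aux_log_c (j : ℕ) : 0 < (cAux j).1 ∧ 0 < (cAux j).2 ∧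
    ((j:ℝ)+1) * Real.log cB1 - ((j:ℝ)+1)/((j:ℝ)+2) * Real.log 2 ≤ Real.log (cAux j).2 := by
  induction j with
  | zero =>
    have := aux_cB1_pos
    refine ⟨by simp only [cAux]; positivity, by simp only [cAux]; positivity, ?_⟩
    simp only [cAux]
    rw [Real.log_div (by positivity) (by positivity), Real.log_sqrt (by norm_num)]
    push_cast
    apply le_of_eq; ring
  | succ j ih =>
    obtain ⟨p1, p2, l2⟩ := ih
    obtain ⟨r1, -, s1, -⟩ := aux_log_d j
    have q1 : 0 < (cAux (j+1)).1 := by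
      simp only [cAux, dHat]; positivity
    have k1 : ((j:ℝ)+2)*((j:ℝ)+2)/((j:ℝ)+3) * Real.log cB1 + ((j:ℝ)+2)/(((j:ℝ)+1)*((j:ℝ)+3)) *
          (((j:ℝ)+1) * Real.log cB1 - ((j:ℝ)+1)/((j:ℝ)+2) * Real.log 2)
          ≤ Real.log (cAux (j+1)).1 := by
      simp only [cAux, dHat]
      rw [Real.log_mul (by positivity) (by positivity), Real.log_rpow (by positivity),
        Real.log_rpow p2]
      have a1 : 2*((j:ℝ)+2) * (((j:ℝ)+1) * Real.log cB1) ≤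
          Real.log (1 + (dAux j).1 ^ (2*((j:ℝ)+2))) := by
        calc _ ≤ 2*((j:ℝ)+2) * Real.log (dAux j).1 := by gcongr
          _ = Real.log ((dAux j).1 ^ (2*((j:ℝ)+2))) := (Real.log_rpow r1 _).symm
          _ ≤ _ := Real.log_le_log (by positivity) (by linarith)
      calc _ = ((j:ℝ)+2) / (2*((j:ℝ)+1)*((j:ℝ)+3)) * (2*((j:ℝ)+2) * (((j:ℝ)+1) * Real.log cB1))
            + ((j:ℝ)+2) / (((j:ℝ)+1)*((j:ℝ)+3)) *
            (((j:ℝ)+1) * Real.log cB1 - ((j:ℝ)+1)/((j:ℝ)+2) * Real.log 2) := by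
              field_simp
        _ ≤ _ := by gcongr
    refine ⟨q1, ?_, ?_⟩
    · show 0 < (cAux j).2 * (cAux (j+1)).1 ^ _
      positivity
    · show _ ≤ Real.log ((cAux j).2 * (cAux (j+1)).1 ^ (1/((j:ℝ)+2)))
      rw [Real.log_mul (by positivity) (by positivity), Real.log_rpow q1]
      push_cast
      refine le_trans (le_of_eq ?_) (add_le_add l2
        (mul_le_mul_of_nonneg_left k1 (by positivity : 0 ≤ 1/((j:ℝ)+2))))
      field_simp
      ring

lemma aux_cConst (j : ℕ) : cConst (j+2) = (cAux j).2 := by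
  unfold cConst
  rw [show j+2-1 = j+1 by omega]
  induction j with
  | zero => simp [cHat, cAux]
  | succ j ih =>
    rw [Finset.prod_range_succ, ih]
    show _ = (cAux j).2 * (cAux (j+1)).1 ^ (1/((j:ℝ)+2))
    rw [cHat]
    push_cast
    ring_nf

lemma aux_chain (b : ℕ → ℝ) (r l : ℝ) (m : ℕ) (h1 : 1 ≤ m → 2 * b 1 ≤ r - l + b 0 + b 2)
    (h2 : ∀ i, 2 ≤ i → i ≤ m → 2 * b i ≤ r + b (i-1) + b (i+1)) :
    ∀ i, 1 ≤ i → i ≤ m → b 1 - b 0 - i * r + l ≤ b (i+1) - b i := by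
  intro i hi
  induction i, hi using Nat.le_induction with
  | base => intro h; have := h1 h; push_cast; linarith
  | succ i hi ih =>
    intro h
    have a := ih (by omega)
    have c := h2 (i+1) (by omega) h
    simp only [Nat.add_sub_cancel] at c
    push_cast
    linarith

lemma aux_chain2 (b : ℕ → ℝ) (r l : ℝ) (m : ℕ) (h1 : 1 ≤ m → 2 * b 1 ≤ r - l + b 0 + b 2)
    (h2 : ∀ i, 2 ≤ i → i ≤ m → 2 * b i ≤ r + b (i-1) + b (i+1)) :
    ∀ i, i ≤ m → ((i:ℝ)+1) * b 1 ≤ i * b 0 + b (i+1) + r * (i*(i+1)/2) - i * l := by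
  intro i
  induction i with
  | zero => intro _; simp
  | succ i ih =>
    intro h
    have a := ih (by omega)
    have c := aux_chain b r l m h1 h2 (i+1) (by omega) h
    push_cast at *
    nlinarith

/-- the weighted norms, abstractly -/
noncomputable def auxS (N t : ℕ → ℝ) (i : ℕ) : ℝ :=
  Real.sqrt (∑ j ∈ Finset.Icc 1 i, N j ^ 2 / t j ^ (2 * (i - j)))

lemma auxS_nonneg (N t : ℕ → ℝ) (i : ℕ) : 0 ≤ auxS N t i := Real.sqrt_nonneg _

lemma auxS_term (N t : ℕ → ℝ) (i j : ℕ) : 0 ≤ N j ^ 2 / t j ^ (2 * (i - j)) := by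
  rw [pow_mul]; positivity

lemma auxS_sq (N t : ℕ → ℝ) (i : ℕ) :
    auxS N t i ^ 2 = ∑ j ∈ Finset.Icc 1 i, N j ^ 2 / t j ^ (2 * (i - j)) :=
  Real.sq_sqrt (Finset.sum_nonneg fun j _ => auxS_term N t i j)

lemma auxS_ge (N t : ℕ → ℝ) (i : ℕ) (hi : 1 ≤ i) : N i ≤ auxS N t i := by
  apply Real.le_sqrt_of_sq_le
  have := Finset.single_le_sum (f := fun j => N j ^ 2 / t j ^ (2 * (i - j)))
    (fun j _ => auxS_term N t i j) (Finset.mem_Icc.2 ⟨hi, le_rfl⟩)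
  simpa using this

lemma auxS_ge2 (N t : ℕ → ℝ) (i : ℕ) (hi : 1 ≤ i) :
    Real.sqrt (N i ^ 2 / t i ^ 2 + N (i+1) ^ 2) ≤ auxS N t (i+1) := by
  apply Real.sqrt_le_sqrt
  rw [Finset.sum_Icc_succ_top (by omega)]
  have := Finset.single_le_sum (f := fun j => N j ^ 2 / t j ^ (2 * (i + 1 - j)))
    (fun j _ => auxS_term N t (i+1) j) (Finset.mem_Icc.2 ⟨hi, le_rfl⟩)
  simp at this ⊢
  exact this

lemma auxS_step (N t : ℕ → ℝ) (i : ℕ) (hi : 1 ≤ i) (hN : 0 ≤ N i)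
    (h : N (i+1) ^ 2 ≤ 40 * (N i * Real.sqrt (N (i+1) ^ 2 / t (i+1) ^ 2 + N (i+2) ^ 2))) :
    auxS N t (i+1) ^ 2 ≤ 41 * (auxS N t i * auxS N t (i+2)) := by
  rw [auxS_sq, Finset.sum_Icc_succ_top (by omega)]
  have h1 : N (i+1) ^ 2 ≤ 40 * (auxS N t i * auxS N t (i+2)) := by
    refine h.trans ?_
    gcongr
    · exact auxS_nonneg _ _ _
    · exact auxS_ge N t i hi
    · exact auxS_ge2 N t (i+1) (by omega)
  have h2 : ∑ j ∈ Finset.Icc 1 i, N j ^ 2 / t j ^ (2 * (i + 1 - j)) ≤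
      auxS N t i * auxS N t (i+2) := by
    calc _ = ∑ j ∈ Finset.Icc 1 i, (N j / t j ^ (i-j)) * (N j / t j ^ (i+2-j)) := by
          apply Finset.sum_congr rfl
          intro j hj
          rw [Finset.mem_Icc] at hj
          rw [div_mul_div_comm, ← pow_add, ← sq]
          congr 2
          omega
      _ ≤ _ := Real.sum_mul_le_sqrt_mul_sqrt _ _ _
      _ ≤ _ := by
          unfold auxS
          gcongr with j hj
          · apply le_of_eq; rw [div_pow, ← pow_mul, mul_comm]
          · calc _ = ∑ j ∈ Finset.Icc 1 i, N j ^ 2 / t j ^ (2 * (i + 2 - j)) := by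
                  apply Finset.sum_congr rfl
                  intro j _
                  rw [div_pow, ← pow_mul, mul_comm 2]
              _ ≤ _ := Finset.sum_le_sum_of_subset_of_nonneg
                    (Finset.Icc_subset_Icc_right (by omega)) (fun j _ _ => auxS_term N t (i+2) j)
  simp only [Nat.sub_self, mul_zero, pow_zero, div_one]
  linarith

lemma aux_final (N t : ℕ → ℝ) (p : ℕ) (hN : ∀ i, 0 ≤ N i)
    (h : ∀ i, i ≤ p →
      N (i+1) ^ 2 ≤ 40 * (N i * Real.sqrt (N (i+1) ^ 2 / t (i+1) ^ 2 + N (i+2) ^ 2))) :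
    N 1 ≤ cConst (p+2) * N 0 ^ (((p:ℝ)+1)/((p:ℝ)+2)) * auxS N t (p+2) ^ (1/((p:ℝ)+2)) := by
  obtain ⟨-, c2, lc⟩ := aux_log_c p
  rw [aux_cConst]
  have hcB := aux_cB1
  have hcB0 := aux_cB1_pos
  rcases (hN 1).eq_or_lt with h0 | h0
  · rw [← h0]
    have := auxS_nonneg N t (p+2)
    have := hN 0
    positivity
  have hS1 : auxS N t 1 = N 1 := by simp [auxS, Real.sqrt_sq (hN 1)]
  let B : ℕ → ℝ := fun i => if i = 0 then N 0 else auxS N t i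
  have B0 : B 0 = N 0 := rfl
  have Bs : ∀ i, B (i+1) = auxS N t (i+1) := fun i => by simp [B]
  have Bn : ∀ i, 0 ≤ B i := by
    intro i
    cases i with
    | zero => exact hN 0
    | succ i => rw [Bs]; exact auxS_nonneg _ _ _
  have b1 : B 1 ^ 2 ≤ 40 * (B 0 * B 2) := by
    rw [B0, Bs 0, Bs 1, hS1]
    refine (h 0 (by omega)).trans ?_
    gcongr
    · exact hN 0
    · exact auxS_ge2 N t 1 le_rfl
  have b2 : ∀ i, i + 1 ≤ p → B (i+2) ^ 2 ≤ 41 * (B (i+1) * B (i+3)) := by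
    intro i hi
    rw [Bs, Bs, Bs]
    exact auxS_step N t (i+1) (by omega) (hN _) (h (i+1) hi)
  have B1p : 0 < B 1 := by rw [Bs 0, hS1]; exact h0
  have aux : ∀ x y z C : ℝ, 0 < x → 0 ≤ y → 0 ≤ z → x^2 ≤ C * (y*z) → 0 < y ∧ 0 < z := by
    intro x y z C hx hy hz hh
    constructor
    · rcases hy.eq_or_lt with e | e
      · rw [← e] at hh; nlinarith
      · exact e
    · rcases hz.eq_or_lt with e | e
      · rw [← e] at hh; nlinarith
      · exact e
  have B02 := aux _ _ _ _ B1p (Bn 0) (Bn 2) b1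
  have Bp : ∀ i, i ≤ p → 0 < B (i+2) := by
    intro i
    induction i with
    | zero => intro _; exact B02.2
    | succ i ih => intro hi; exact (aux _ _ _ _ (ih (by omega)) (Bn _) (Bn _) (b2 i hi)).2
  have ch := aux_chain2 (fun i => Real.log (B i)) (2 * Real.log cB1) (Real.log 2) (p+1)
    (by
      intro _
      have : 2 * B 1 ^ 2 ≤ cB1 ^ 2 * (B 0 * B 2) := by
        nlinarith [mul_pos B02.1 B02.2]
      have := Real.log_le_log (by positivity) this
      have z0 := B02.1.ne'
      have z2 := B02.2.ne'
      rw [Real.log_mul (by positivity) (by positivity), Real.log_mul (by positivity) (by positivity),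
        Real.log_mul z0 z2, Real.log_pow, Real.log_pow] at this
      push_cast at this
      linarith)
    (by
      intro i hi hip
      obtain ⟨i, rfl⟩ := Nat.exists_eq_add_of_le' hi
      have x2 := Bp i (by omega)
      have x3 : 0 < B (i+3) := Bp (i+1) (by omega)
      have x1 : 0 < B (i+1) := by
        cases i with
        | zero => exact B1p
        | succ i => exact Bp i (by omega)
      have : B (i+2) ^ 2 ≤ cB1 ^ 2 * (B (i+1) * B (i+3)) := by
        nlinarith [mul_pos x1 x3, b2 i (by omega)]
      have := Real.log_le_log (by positivity) this
      rw [Real.log_mul (by positivity) (by positivity),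
        Real.log_mul x1.ne' x3.ne', Real.log_pow, Real.log_pow] at this
      push_cast at this
      show 2 * Real.log (B (i+2)) ≤ 2 * Real.log cB1 + Real.log (B (i+1)) + Real.log (B (i+3))
      linarith) (p+1) le_rfl
  have xl := Bp p le_rfl
  have x0 := B02.1
  rw [← Bs (p+1), ← B0, ← hS1, ← Bs 0]
  show B 1 ≤ _ * _ * B (p+2) ^ _
  rw [← Real.log_le_log_iff B1p (by positivity), Real.log_mul (by positivity) (by positivity),
    Real.log_mul (by positivity) (by positivity), Real.log_rpow x0, Real.log_rpow xl]
  simp only [show p + 1 + 1 = p + 2 from rfl] at ch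
  push_cast at ch
  generalize Real.log (B 1) = y1 at *
  generalize Real.log (B 0) = y0 at *
  generalize Real.log (B (p+2)) = y2 at *
  have : y1 ≤ (((p:ℝ)+1) * Real.log cB1 - ((p:ℝ)+1)/((p:ℝ)+2) * Real.log 2) +
      ((p:ℝ)+1)/((p:ℝ)+2) * y0 + 1/((p:ℝ)+2) * y2 := by
    have e : (((p:ℝ)+1) * Real.log cB1 - ((p:ℝ)+1)/((p:ℝ)+2) * Real.log 2) +
      ((p:ℝ)+1)/((p:ℝ)+2) * y0 + 1/((p:ℝ)+2) * y2 =
      (((p:ℝ)+1) * ((p:ℝ)+2) * Real.log cB1 - ((p:ℝ)+1) * Real.log 2 + ((p:ℝ)+1) * y0 + y2) /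
        ((p:ℝ)+2) := by field_simp
    rw [e, le_div_iff₀ (by positivity)]
    linarith
  linarith

/-- Lemma 4.7: general (non-periodic) discrete interpolation inequality
`‖D¹f‖₀ ≤ c_m ‖f‖₀^{(m−1)/m} ‖D¹f‖_{m−1}^{1/m}` for `2 ≤ m ≤ M`. -/
theorem general_interpolation
    {X : Type*} [NormedAddCommGroup X] [InnerProductSpace ℝ X] [CompleteSpace X]
    (T : ℝ) (hT : 0 < T) (M : ℕ) (hM : 0 < M) (τ : ℝ) (hτ : τ = T / M)
    (f : ℕ → X) (hmean : ∑ n ∈ Finset.range (M + 1), f n = 0)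
    (m : ℕ) (hm : 2 ≤ m) (hmM : m ≤ M) :
    seqNorm0 τ 1 M (Dq τ f) ≤
      cConst m * (seqNorm0 τ 0 M f) ^ (((m:ℝ)-1)/(m:ℝ)) *
        (normm τ T M 1 (m-1) f) ^ (1/(m:ℝ)) := by
  obtain ⟨p, rfl⟩ := Nat.exists_eq_add_of_le' hm
  have hτ0 : 0 < τ := by rw [hτ]; positivity
  have key := aux_final (fun j => seqNorm0 τ j M ((Dq τ)^[j] f)) (Tk τ T M) p
    (fun i => Real.sqrt_nonneg _) (by
      intro i hi
      obtain ⟨L, rfl⟩ : ∃ L, M = i + L + 1 := ⟨M - i - 1, by omega⟩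
      have := aux_step τ hτ0 ((Dq τ)^[i] f) i L
      have e : Tk τ T (i+L+1) (i+1) = ((L:ℝ)+1)*τ := by
        simp only [Tk, Nat.succ_ne_zero, if_false]
        push_cast
        ring
      simp only [Function.iterate_succ_apply', e]
      exact this)
  have hn : normm τ T M 1 (p+2-1) f =
      auxS (fun j => seqNorm0 τ j M ((Dq τ)^[j] f)) (Tk τ T M) (p+2) := by
    unfold normm auxS
    rw [show 1 + (p+2-1) = p+2 by omega, show p+2-1+1 = p+2 by omega]
  rw [hn]
  have e1 : (((p+2:ℕ):ℝ) - 1) / ((p+2:ℕ):ℝ) = ((p:ℝ)+1)/((p:ℝ)+2) := by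
    push_cast; ring
  have e2 : 1 / ((p+2:ℕ):ℝ) = 1/((p:ℝ)+2) := by push_cast; ring
  rw [e1, e2]
  exact key
end

section
/- Let m and M be integers with 1 ≤ m ≤ M, and let f : ℝ → X be m times continuously differentiable on [0,T]. Let f_n = f(t_n) for 0 ≤ n ≤ M, and set N = (Σ_{k=1}^m T^{−2(m−k)} ∫_0^T ‖∂_t^k f(t)‖² dt)^{1/2}. Then: (i) ‖D^1 f‖_0 ≤ 4 · 2^{(m−1)/m} · c_m · ‖f‖_0^{(m−1)/m} · N^{1/m}; and (ii) for every 0 ≤ n ≤ M, ‖f_n‖ ≤ 2 · 2^{(m−1)/(2m)} · c_A · c_m^{1/2} · ‖f‖_0^{1−1/(2m)} · N^{1/(2m)} + ‖f‖_0/√T. If moreover f_0 + f_1 + ⋯ + f_M = 0, the term ‖f‖_0/√T in (ii) can be omitted. -/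
open Set MeasureTheory intervalIntegral in
lemma aux_cs {a b : ℝ} (hab : a ≤ b) {u v : ℝ → ℝ} (hu : ContinuousOn u (Set.Icc a b))
    (hv : ContinuousOn v (Set.Icc a b)) :
    (∫ t in a..b, u t * v t)^2 ≤ (∫ t in a..b, u t ^ 2) * (∫ t in a..b, v t ^ 2) := by
  have key : ∀ x : ℝ, 0 ≤ (∫ t in a..b, u t ^ 2) * (x * x) + (2 * ∫ t in a..b, u t * v t) * x
      + (∫ t in a..b, v t ^ 2) := by
    intro x
    have i1 : IntervalIntegrable (fun t => u t ^ 2) volume a b :=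
      ContinuousOn.intervalIntegrable_of_Icc hab (hu.pow 2)
    have i2 : IntervalIntegrable (fun t => u t * v t) volume a b :=
      ContinuousOn.intervalIntegrable_of_Icc hab (hu.mul hv)
    have i3 : IntervalIntegrable (fun t => v t ^ 2) volume a b :=
      ContinuousOn.intervalIntegrable_of_Icc hab (hv.pow 2)
    have h0 : 0 ≤ ∫ t in a..b, (x * u t + v t)^2 :=
      intervalIntegral.integral_nonneg hab (fun t _ => sq_nonneg _)
    have h1 : (∫ t in a..b, (x * u t + v t)^2) =
        ∫ t in a..b, (x * x * u t ^ 2 + 2 * x * (u t * v t) + v t ^ 2) := by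
      congr 1; ext t; ring
    rw [h1, intervalIntegral.integral_add ((i1.const_mul _).add (i2.const_mul _)) i3,
      intervalIntegral.integral_add (i1.const_mul _) (i2.const_mul _),
      intervalIntegral.integral_const_mul, intervalIntegral.integral_const_mul] at h0
    linarith
  have := discrim_le_zero key
  unfold discrim at this
  nlinarith

section
variable {X : Type*} [NormedAddCommGroup X] [InnerProductSpace ℝ X] [CompleteSpace X]

lemma aux_ftc {a b : ℝ} {g g' : ℝ → X} (hg : ContinuousOn g (Set.Icc a b))
    (hg' : ContinuousOn g' (Set.Icc a b)) (hd : ∀ t ∈ Set.Ioo a b, HasDerivAt g (g' t) t)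
    {p q : ℝ} (hap : a ≤ p) (hpq : p ≤ q) (hqb : q ≤ b) :
    ‖g q - g p‖ ≤ ∫ t in a..b, ‖g' t‖ := by
  have hsub : Set.Icc p q ⊆ Set.Icc a b := Set.Icc_subset_Icc hap hqb
  have h1 := intervalIntegral.integral_eq_sub_of_hasDerivAt_of_le hpq (hg.mono hsub)
    (fun t ht => hd t ⟨hap.trans_lt ht.1, ht.2.trans_le hqb⟩)
    (ContinuousOn.intervalIntegrable_of_Icc hpq (hg'.mono hsub))
  rw [← h1]
  refine (intervalIntegral.norm_integral_le_integral_norm hpq).trans ?_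
  exact intervalIntegral.integral_mono_interval hap hpq hqb
    (Filter.Eventually.of_forall fun t => norm_nonneg _)
    (ContinuousOn.intervalIntegrable_of_Icc (hap.trans (hpq.trans hqb)) hg'.norm)

/-- Agmon pre-inequality. -/
lemma aux_agmon0 {T : ℝ} {g g' : ℝ → X} (hg : ContinuousOn g (Set.Icc 0 T))
    (hg' : ContinuousOn g' (Set.Icc 0 T)) (hd : ∀ t ∈ Set.Ioo 0 T, HasDerivAt g (g' t) t)
    {p q : ℝ} (hp : p ∈ Set.Icc 0 T) (hq : q ∈ Set.Icc 0 T) :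
    ‖g q‖^2 - ‖g p‖^2 ≤ 2 * ∫ t in (0:ℝ)..T, ‖g t‖ * ‖g' t‖ := by
  have hT : 0 ≤ T := hp.1.trans hp.2
  have hD : ∀ t ∈ Set.Ioo 0 T, HasDerivAt (fun t => ‖g t‖^2) (2 * inner ℝ (g t) (g' t)) t :=
    fun t ht => (hd t ht).norm_sq
  have hc : ContinuousOn (fun t => 2 * inner ℝ (g t) (g' t)) (Set.Icc 0 T) :=
    continuousOn_const.mul (hg.inner hg')
  have hb : (∫ t in (0:ℝ)..T, ‖2 * inner ℝ (g t) (g' t)‖) ≤ 2 * ∫ t in (0:ℝ)..T, ‖g t‖ * ‖g' t‖ := by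
    rw [← intervalIntegral.integral_const_mul]
    refine intervalIntegral.integral_mono_on hT
      (ContinuousOn.intervalIntegrable_of_Icc hT hc.norm)
      (ContinuousOn.intervalIntegrable_of_Icc hT (continuousOn_const.mul (hg.norm.mul hg'.norm))) ?_
    intro t _
    rw [norm_mul]
    simpa using norm_inner_le_norm (𝕜 := ℝ) (g t) (g' t)
  have hcg : ContinuousOn (fun t => ‖g t‖^2) (Set.Icc 0 T) := hg.norm.pow 2
  rcases le_total p q with h | h
  · have := aux_ftc hcg hc hD hp.1 h hq.2
    exact (le_abs_self _).trans (this.trans hb)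
  · have := aux_ftc hcg hc hD hq.1 h hp.2
    rw [norm_sub_rev] at this
    exact (le_abs_self _).trans (this.trans hb)

/-- L2 norm on `[0,T]`. -/
noncomputable def LN (T : ℝ) (g : ℝ → X) : ℝ := Real.sqrt (∫ t in (0:ℝ)..T, ‖g t‖^2)

lemma LN_nonneg (T : ℝ) (g : ℝ → X) : 0 ≤ LN T g := Real.sqrt_nonneg _

lemma LN_sq {T : ℝ} (hT : 0 ≤ T) (g : ℝ → X) : LN T g ^ 2 = ∫ t in (0:ℝ)..T, ‖g t‖^2 :=
  Real.sq_sqrt (intervalIntegral.integral_nonneg hT (fun t _ => sq_nonneg _))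

lemma aux_csn {T : ℝ} (hT : 0 ≤ T) {g h : ℝ → X} (hg : ContinuousOn g (Set.Icc 0 T))
    (hh : ContinuousOn h (Set.Icc 0 T)) :
    (∫ t in (0:ℝ)..T, ‖g t‖ * ‖h t‖) ≤ LN T g * LN T h := by
  have := aux_cs hT hg.norm hh.norm
  rw [← LN_sq hT, ← LN_sq hT, ← mul_pow] at this
  exact (abs_le.1 (abs_le_of_sq_le_sq this (mul_nonneg (LN_nonneg _ _) (LN_nonneg _ _)))).2

lemma aux_agmon {T : ℝ} (hT : 0 < T) {g g' : ℝ → X} (hg : ContinuousOn g (Set.Icc 0 T))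
    (hg' : ContinuousOn g' (Set.Icc 0 T)) (hd : ∀ t ∈ Set.Ioo 0 T, HasDerivAt g (g' t) t)
    {q : ℝ} (hq : q ∈ Set.Icc 0 T) :
    ‖g q‖^2 ≤ 2 * (LN T g * LN T g') + LN T g ^ 2 / T := by
  have h1 : ∀ p ∈ Set.Icc 0 T, ‖g q‖^2 - 2 * (LN T g * LN T g') ≤ ‖g p‖^2 := by
    intro p hp
    have := aux_agmon0 hg hg' hd hp hq
    have := aux_csn hT.le hg hg'
    linarith
  have h2 := intervalIntegral.integral_mono_on hT.le (μ := MeasureTheory.volume)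
    (intervalIntegrable_const)
    (ContinuousOn.intervalIntegrable_of_Icc hT.le (hg.norm.pow 2)) h1
  rw [intervalIntegral.integral_const, sub_zero, smul_eq_mul] at h2
  have h3 := LN_sq hT.le g
  have : ‖g q‖^2 - 2 * (LN T g * LN T g') ≤ LN T g ^ 2 / T := by
    rw [le_div_iff₀ hT, h3, mul_comm]; exact h2
  linarith

lemma aux_three {T : ℝ} (hT : 0 < T) {g g' g'' : ℝ → X} (hg : ContinuousOn g (Set.Icc 0 T))
    (hg' : ContinuousOn g' (Set.Icc 0 T)) (hg'' : ContinuousOn g'' (Set.Icc 0 T))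
    (hd : ∀ t ∈ Set.Ioo 0 T, HasDerivAt g (g' t) t)
    (hd' : ∀ t ∈ Set.Ioo 0 T, HasDerivAt g' (g'' t) t) :
    LN T g' ^ 2 ≤ 26 * LN T g * (LN T g'' + LN T g' / T) := by
  have ha := LN_nonneg T g
  have hb := LN_nonneg T g'
  have hc := LN_nonneg T g''
  have hT0 : (0:ℝ) ∈ Set.Icc 0 T := ⟨le_rfl, hT.le⟩
  have hTT : T ∈ Set.Icc 0 T := ⟨hT.le, le_rfl⟩
  have hip : (∫ t in (0:ℝ)..T, (inner ℝ (g t) (g'' t) + inner ℝ (g' t) (g' t)))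
      = inner ℝ (g T) (g' T) - inner ℝ (g 0) (g' 0) := by
    refine intervalIntegral.integral_eq_sub_of_hasDerivAt_of_le hT.le (hg.inner hg')
      (fun t ht => (hd t ht).inner ℝ (hd' t ht)) ?_
    exact ContinuousOn.intervalIntegrable_of_Icc hT.le ((hg.inner hg'').add (hg'.inner hg'))
  have i1 := ContinuousOn.intervalIntegrable_of_Icc (μ := MeasureTheory.volume) hT.le (hg.inner (𝕜 := ℝ) hg'')
  have i2 := ContinuousOn.intervalIntegrable_of_Icc (μ := MeasureTheory.volume) hT.le (hg'.inner (𝕜 := ℝ) hg')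
  rw [intervalIntegral.integral_add i1 i2] at hip
  have hsq : (∫ t in (0:ℝ)..T, inner ℝ (g' t) (g' t)) = LN T g' ^ 2 := by
    rw [LN_sq hT.le]; congr 1; ext t; exact real_inner_self_eq_norm_sq _
  have hI : -(∫ t in (0:ℝ)..T, inner ℝ (g t) (g'' t)) ≤ LN T g * LN T g'' := by
    refine le_trans ?_ (aux_csn hT.le hg hg'')
    rw [← intervalIntegral.integral_neg]
    refine intervalIntegral.integral_mono_on hT.le i1.neg
      (ContinuousOn.intervalIntegrable_of_Icc hT.le (hg.norm.mul hg''.norm)) ?_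
    intro t _
    exact (neg_le_abs _).trans (abs_real_inner_le_norm _ _)
  rw [hsq] at hip
  set a := LN T g
  set b := LN T g'
  set c := LN T g''
  have hbT : 0 ≤ b / T := div_nonneg hb hT.le
  rcases le_total (T * b) a with hcase | hcase
  · have h1 : b ≤ a / T := by rw [le_div_iff₀ hT]; linarith
    have h2 : b ^ 2 ≤ a * (b / T) := by
      calc b^2 = b * b := by ring
        _ ≤ (a / T) * b := by gcongr
        _ = a * (b/T) := by ring
    nlinarith [mul_nonneg ha hc, mul_nonneg ha hbT]
  · have hA : ∀ q ∈ Set.Icc 0 T, ‖g q‖^2 ≤ 3 * (a * b) := by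
      intro q hq
      have h := aux_agmon hT hg hg' hd hq
      have : a ^ 2 / T ≤ a * b := by
        rw [div_le_iff₀ hT]; nlinarith
      linarith
    have hB : ∀ q ∈ Set.Icc 0 T, ‖g' q‖^2 ≤ 2 * (b * (c + b/T)) := by
      intro q hq
      have h := aux_agmon hT hg' hg'' hd' hq
      have e : LN T g' ^ 2 / T = b * (b / T) := by simp only [b]; ring
      rw [e] at h
      have := mul_nonneg hb hbT
      change ‖g' q‖^2 ≤ 2 * (b * c) + b * (b/T) at h
      nlinarith
    set h := c + b / T with hh
    have hh0 : 0 ≤ h := add_nonneg hc hbT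
    have hC : ∀ q ∈ Set.Icc 0 T, |inner ℝ (g q) (g' q)| ≤ b * Real.sqrt (6 * a * h) := by
      intro q hq
      refine (abs_real_inner_le_norm _ _).trans ?_
      refine (le_abs_self _).trans (abs_le_of_sq_le_sq (a := ‖g q‖ * ‖g' q‖) ?_ (by positivity))
      rw [mul_pow, mul_pow, Real.sq_sqrt (by positivity)]
      calc ‖g q‖^2 * ‖g' q‖^2 ≤ (3 * (a*b)) * (2 * (b * h)) := by
            gcongr
            · exact hA q hq
            · exact hB q hq
        _ = _ := by ring
    have h3 := (abs_le.1 (hC T hTT)).2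
    have h4 := (abs_le.1 (hC 0 hT0)).1
    have h5 : a * c ≤ a * h := by gcongr; linarith
    have h6 := Real.sq_sqrt (show 0 ≤ 6 * a * h by positivity)
    set r := Real.sqrt (6*a*h)
    have h7 : b^2 ≤ a * h + 2 * (b * r) := by linarith
    nlinarith [sq_nonneg (b - 2 * r)]
end

lemma aux_P {E : ℕ → ℝ} (hE : ∀ k, 0 ≤ E k) {L : ℝ} (hL : 0 < L) {m : ℕ}
    (h : ∀ k, k + 2 ≤ m → E (k+1) ^ 2 ≤ L^2 * (E k * E (k+2))) :
    ∀ k, k + 1 ≤ m → E k ^ (k+1) ≤ L ^ (k*(k+1)) * (E 0 * E (k+1) ^ k) := by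
  intro k
  induction k with
  | zero => intro _; simp
  | succ k ih =>
    intro hk
    have ih' := ih (by omega)
    have h1 := h k (by omega)
    rcases (hE (k+1)).eq_or_lt with h0 | h0
    · rw [← h0, zero_pow (by omega)]
      have := hE 0
      have := hE (k+1+1)
      positivity
    · have h2 : (E (k+1) ^ 2)^(k+1) ≤ (L^2 * (E k * E (k+2)))^(k+1) := by gcongr
      have h3 : (L^2 * (E k * E (k+2)))^(k+1) ≤
          (L^2)^(k+1) * ((L ^ (k*(k+1)) * (E 0 * E (k+1) ^ k)) * E (k+2)^(k+1)) := by
        rw [mul_pow, mul_pow]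
        have := hE (k+2)
        gcongr
      have h4 := h2.trans h3
      refine le_of_mul_le_mul_left ?_ (pow_pos h0 k)
      calc E (k+1) ^ k * E (k+1) ^ (k+1+1) = (E (k+1) ^ 2)^(k+1) := by
            rw [← pow_mul, ← pow_add]; congr 1; ring
        _ ≤ _ := h4
        _ = _ := by
            rw [← pow_mul]
            rw [show (k+1)*(k+1+1) = 2*(k+1) + k*(k+1) by ring, pow_add L]
            ring

lemma aux_Q {E : ℕ → ℝ} (hE : ∀ k, 0 ≤ E k) {L : ℝ} (hL : 0 < L) {m : ℕ}
    (h : ∀ k, k + 2 ≤ m → E (k+1) ^ 2 ≤ L^2 * (E k * E (k+2))) :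
    ∀ k, k + 1 ≤ m → E 1 ^ (k+1) ≤ L ^ (k*(k+1)) * (E 0 ^ k * E (k+1)) := by
  intro k
  induction k with
  | zero => intro _; simp
  | succ k ih =>
    intro hk
    have ih' := ih (by omega)
    have hp := aux_P hE hL h (k+1) hk
    have e0 := hE 0
    have e1 := hE 1
    have e2 := hE (k+1)
    have e3 := hE (k+1+1)
    refine le_of_pow_le_pow_left₀ (n := k+1) (by omega) (by positivity) ?_
    calc (E 1 ^ (k+1+1))^(k+1) = (E 1 ^ (k+1))^(k+1+1) := by rw [← pow_mul, ← pow_mul, mul_comm]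
      _ ≤ (L ^ (k*(k+1)) * (E 0 ^ k * E (k+1)))^(k+1+1) := by gcongr
      _ = (L ^ (k*(k+1)))^(k+1+1) * ((E 0 ^ k)^(k+1+1) * E (k+1)^(k+1+1)) := by rw [mul_pow, mul_pow]
      _ ≤ (L ^ (k*(k+1)))^(k+1+1) * ((E 0 ^ k)^(k+1+1) *
            (L ^ ((k+1)*(k+1+1)) * (E 0 * E (k+1+1) ^ (k+1)))) := by gcongr
      _ = _ := by
        rw [mul_pow, mul_pow, ← pow_mul, ← pow_mul, ← pow_mul, ← pow_mul]
        rw [show (k+1)*(k+1+1)*(k+1) = k*(k+1)*(k+1+1) + (k+1)*(k+1+1) by ring, pow_add L,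
          show (k+1)*(k+1) = k*(k+1+1) + 1 by ring, pow_succ (E 0)]
        ring

lemma cB1_ge : 15/2 * Real.sqrt 2 ≤ cB1 := by
  have h2 : (1.41:ℝ) ≤ Real.sqrt 2 := Real.le_sqrt_of_sq_le (by norm_num)
  have h2' : Real.sqrt 2 ^ 2 = 2 := Real.sq_sqrt (by norm_num)
  have hA2 : (2.7:ℝ) ≤ cA ^ 2 := by
    unfold cA; rw [Real.sq_sqrt (by positivity)]; linarith
  have hA : (1.64:ℝ) ≤ cA := by
    unfold cA; exact Real.le_sqrt_of_sq_le (by linarith)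
  have hx : (2.3:ℝ) ≤ Real.sqrt 2 * cA := by nlinarith
  have hx2 : (2.3:ℝ) ≤ (Real.sqrt 2 * cA) ^ ((4:ℝ)/3) := by
    refine hx.trans ?_
    conv_lhs => rw [← Real.rpow_one (Real.sqrt 2 * cA)]
    exact Real.rpow_le_rpow_of_exponent_le (by linarith) (by norm_num)
  have h1 : (2.3:ℝ) ≤ cA1 := by
    unfold cA1
    have : (3.3:ℝ) ^ ((3:ℝ)/4) ≤ (1 + (Real.sqrt 2 * cA) ^ ((4:ℝ)/3)) ^ ((3:ℝ)/4) :=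
      Real.rpow_le_rpow (by norm_num) (by linarith) (by norm_num)
    refine le_trans ?_ this
    refine le_of_pow_le_pow_left₀ (n := 4) (by norm_num) (by positivity) ?_
    rw [← Real.rpow_natCast ((3.3:ℝ) ^ ((3:ℝ)/4)), ← Real.rpow_mul (by norm_num)]
    norm_num
  have hm : (14:ℝ) ≤ (cA * cA1)^2 := by
    rw [mul_pow]
    have : (5.29:ℝ) ≤ cA1 ^ 2 := by nlinarith
    nlinarith
  unfold cB1
  have : 15/4 * Real.sqrt 2 ≤ Real.sqrt (1 + 2 * (cA * cA1)^2) := by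
    apply Real.le_sqrt_of_sq_le
    rw [mul_pow, h2']; linarith
  linarith

lemma rec_ge {B : ℝ} (hB : 1 ≤ B) (j : ℕ) {x p : ℝ} (hx : B ^ ((j:ℝ)+1) ≤ x)
    (hp : B ^ ((j:ℝ)+1) ≤ p) :
    B ^ ((j:ℝ)+2) ≤ (1 + x ^ (2*((j:ℝ)+2))) ^ (((j:ℝ)+2) / (2*((j:ℝ)+1)*((j:ℝ)+3))) *
                   p ^ (((j:ℝ)+2) / (((j:ℝ)+1)*((j:ℝ)+3))) := by
  have hB0 : 0 < B := by linarith
  have h1 : B ^ (((j:ℝ)+1) * (2*((j:ℝ)+2))) ≤ 1 + x ^ (2*((j:ℝ)+2)) := by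
    rw [Real.rpow_mul hB0.le]
    have := Real.rpow_le_rpow (by positivity) hx (show 0 ≤ 2*((j:ℝ)+2) by positivity)
    linarith
  have h2 := Real.rpow_le_rpow (by positivity) h1
    (show 0 ≤ ((j:ℝ)+2) / (2*((j:ℝ)+1)*((j:ℝ)+3)) by positivity)
  have h3 := Real.rpow_le_rpow (by positivity) hp
    (show 0 ≤ ((j:ℝ)+2) / (((j:ℝ)+1)*((j:ℝ)+3)) by positivity)
  rw [← Real.rpow_mul hB0.le] at h2 h3
  refine le_trans (le_of_eq ?_) (mul_le_mul h2 h3 (by positivity) (le_trans (by positivity) h2))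
  rw [← Real.rpow_add hB0]
  congr 1
  field_simp
  ring

lemma rec_prod {B : ℝ} (hB : 1 ≤ B) (j : ℕ) {d p : ℝ} (hd : B ^ ((j:ℝ)+2) ≤ d)
    (hp : B ^ ((j:ℝ)+1) ≤ p) : B ^ ((j:ℝ)+2) ≤ p * d ^ (1/((j:ℝ)+2)) := by
  have hB0 : 0 < B := by linarith
  have h3 := Real.rpow_le_rpow (by positivity) hd (show 0 ≤ 1/((j:ℝ)+2) by positivity)
  rw [← Real.rpow_mul hB0.le] at h3
  refine le_trans (le_of_eq ?_) (mul_le_mul hp h3 (by positivity) (le_trans (by positivity) hp))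
  rw [← Real.rpow_add hB0]
  congr 1
  field_simp
  ring

lemma dAux_ge {B : ℝ} (hB : 1 ≤ B) (h : B ≤ cB1) (j : ℕ) :
    B ^ ((j:ℝ)+1) ≤ (dAux j).1 ∧ B ^ ((j:ℝ)+1) ≤ (dAux j).2 := by
  induction j with
  | zero => simpa [dAux] using h
  | succ j ih =>
    have e : ((j+1:ℕ):ℝ) + 1 = (j:ℝ) + 2 := by push_cast; ring
    rw [e]
    have h1 := rec_ge hB j ih.1 ih.2
    exact ⟨h1, rec_prod hB j h1 ih.2⟩

lemma cAux_ge {B : ℝ} (hB : 1 ≤ B) (h : B ≤ cB1) (h' : B ≤ cB1 / Real.sqrt 2) (j : ℕ) :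
    B ^ ((j:ℝ)+1) ≤ (cAux j).1 ∧ B ^ ((j:ℝ)+1) ≤ (cAux j).2 := by
  induction j with
  | zero => simpa [cAux] using h'
  | succ j ih =>
    have e : ((j+1:ℕ):ℝ) + 1 = (j:ℝ) + 2 := by push_cast; ring
    rw [e]
    have h1 := rec_ge hB j (dAux_ge hB h j).1 ih.2
    exact ⟨h1, rec_prod hB j h1 ih.2⟩

lemma cConst_ge (m : ℕ) : (15/2:ℝ)^(m-1) ≤ cConst m := by
  have h := cB1_ge
  have h2 : (1:ℝ) ≤ Real.sqrt 2 := Real.one_le_sqrt.2 (by norm_num)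
  have h' : (15/2:ℝ) ≤ cB1 / Real.sqrt 2 := by rw [le_div_iff₀ (by positivity)]; exact h
  have h'' : (15/2:ℝ) ≤ cB1 := by linarith
  unfold cConst
  calc (15/2:ℝ)^(m-1) = ∏ j ∈ Finset.range (m-1), (15/2:ℝ) := by
        rw [Finset.prod_const, Finset.card_range]
    _ ≤ _ := by
      refine Finset.prod_le_prod (fun _ _ => by norm_num) (fun j _ => ?_)
      have h1 := (cAux_ge (by norm_num) h'' h' j).1
      have h3 := Real.rpow_le_rpow (by positivity) h1 (show 0 ≤ 1/((j:ℝ)+1) by positivity)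
      rw [← Real.rpow_mul (by norm_num), mul_one_div_cancel (by positivity), Real.rpow_one] at h3
      exact h3

lemma sum_Icc_one {R : Type*} [AddCommMonoid R] (F : ℕ → R) (M : ℕ) :
    ∑ n ∈ Finset.Icc 1 M, F n = ∑ i ∈ Finset.range M, F (i+1) := by
  induction M with
  | zero => simp
  | succ M ih => rw [Finset.sum_Icc_succ_top (by omega), Finset.sum_range_succ, ih]

lemma sum_Icc_zero {R : Type*} [AddCommMonoid R] (F : ℕ → R) (M : ℕ) :
    ∑ n ∈ Finset.Icc 0 M, F n = ∑ i ∈ Finset.range (M+1), F i := by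
  congr 1; ext i; simp

section
variable {X : Type*} [NormedAddCommGroup X] [InnerProductSpace ℝ X]

lemma seq0_sq {τ : ℝ} (hτ : 0 < τ) (M : ℕ) (s : ℕ → X) :
    seqNorm0 τ 0 M s ^ 2 = τ * ∑ i ∈ Finset.range (M+1), ‖s i‖^2 := by
  unfold seqNorm0
  rw [Real.sq_sqrt (mul_nonneg hτ.le (Finset.sum_nonneg fun _ _ => by positivity)), sum_Icc_zero]

lemma seq1_sq {τ : ℝ} (hτ : 0 < τ) (M : ℕ) (s : ℕ → X) :
    seqNorm0 τ 1 M (Dq τ s) ^ 2 = τ⁻¹ * ∑ i ∈ Finset.range M, ‖s (i+1) - s i‖^2 := by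
  unfold seqNorm0
  rw [Real.sq_sqrt (mul_nonneg hτ.le (Finset.sum_nonneg fun _ _ => by positivity)), sum_Icc_one,
    Finset.mul_sum, Finset.mul_sum]
  refine Finset.sum_congr rfl fun i _ => ?_
  simp only [Dq, Nat.add_sub_cancel, norm_smul, norm_inv, Real.norm_eq_abs, abs_of_pos hτ]
  field_simp

lemma seq_nonneg (τ : ℝ) (a b : ℕ) (s : ℕ → X) : 0 ≤ seqNorm0 τ a b s := Real.sqrt_nonneg _

lemma tele {E : Type*} [SeminormedAddCommGroup E] (x : ℕ → E) {M p q : ℕ} (hp : p ≤ M) (hq : q ≤ M) :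
    ‖x p - x q‖ ≤ ∑ i ∈ Finset.range M, ‖x (i+1) - x i‖ := by
  wlog h : p ≤ q generalizing p q
  · rw [norm_sub_rev]; exact this hq hp (by omega)
  have h1 := dist_le_Ico_sum_dist x h
  rw [dist_eq_norm] at h1
  refine h1.trans ?_
  refine le_trans (Finset.sum_le_sum_of_subset_of_nonneg (t := Finset.range M) ?_
    (fun _ _ _ => dist_nonneg)) (le_of_eq ?_)
  · intro i hi; simp at hi ⊢; omega
  · refine Finset.sum_congr rfl fun i _ => ?_
    rw [dist_comm, dist_eq_norm]

lemma disc_diff {τ : ℝ} (hτ : 0 < τ) {M : ℕ} (s : ℕ → X) {n k : ℕ} (hn : n ≤ M) (hk : k ≤ M) :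
    ‖s n‖^2 - ‖s k‖^2 ≤ 2 * (seqNorm0 τ 1 M (Dq τ s) * seqNorm0 τ 0 M s) := by
  set S := seqNorm0 τ 0 M s with hS
  set d := seqNorm0 τ 1 M (Dq τ s) with hd
  have hS0 : 0 ≤ S := seq_nonneg _ _ _ _
  have hd0 : 0 ≤ d := seq_nonneg _ _ _ _
  have hS2 := seq0_sq hτ M s
  have hd2 := seq1_sq hτ M s
  have h1 := tele (fun i => ‖s i‖^2) hn hk
  have h2 := (le_abs_self _).trans h1
  refine h2.trans ?_
  have h3 : ∀ i, ‖‖s (i+1)‖^2 - ‖s i‖^2‖ ≤ ‖s (i+1) - s i‖ * ‖s (i+1)‖ + ‖s (i+1) - s i‖ * ‖s i‖ := by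
    intro i
    rw [sq_sub_sq, norm_mul, mul_comm, ← mul_add]
    refine mul_le_mul (abs_norm_sub_norm_le _ _) ?_ (norm_nonneg _) (norm_nonneg _)
    rw [Real.norm_eq_abs, abs_of_nonneg (by positivity)]
  have cs : ∀ F : ℕ → ℝ, τ * ∑ i ∈ Finset.range M, F i ^ 2 ≤ S^2 →
      ∑ i ∈ Finset.range M, ‖s (i+1) - s i‖ * F i ≤ d * S := by
    intro F hF
    have hc := Finset.sum_mul_sq_le_sq_mul_sq (Finset.range M) (fun i => ‖s (i+1) - s i‖) F
    refine (le_abs_self _).trans (abs_le_of_sq_le_sq ?_ (by positivity))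
    refine hc.trans ?_
    rw [mul_pow, hd2]
    have : 0 ≤ τ⁻¹ * ∑ i ∈ Finset.range M, ‖s (i+1) - s i‖^2 := by rw [← hd2]; positivity
    calc _ = (τ⁻¹ * ∑ i ∈ Finset.range M, ‖s (i+1) - s i‖^2) * (τ * ∑ i ∈ Finset.range M, F i ^ 2) := by
          field_simp
      _ ≤ _ := by gcongr
  have c1 := cs (fun i => ‖s (i+1)‖) (by
    rw [hS2, Finset.sum_range_succ']
    have := sq_nonneg ‖s 0‖
    gcongr; linarith)
  have c2 := cs (fun i => ‖s i‖) (by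
    rw [hS2, Finset.sum_range_succ]
    have := sq_nonneg ‖s M‖
    gcongr; linarith)
  have h4 := Finset.sum_le_sum (fun i (_ : i ∈ Finset.range M) => h3 i)
  rw [Finset.sum_add_distrib] at h4
  linarith

lemma sum_sub_sq (s : ℕ → X) (L : ℕ) (x : X) :
    ∑ k ∈ Finset.range L, ‖s k - x‖^2 =
      ∑ k ∈ Finset.range L, ‖s k‖^2 - 2 * inner ℝ (∑ k ∈ Finset.range L, s k) x + L * ‖x‖^2 := by
  simp_rw [norm_sub_sq_real]
  rw [Finset.sum_add_distrib, Finset.sum_sub_distrib, ← Finset.mul_sum, sum_inner]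
  simp

lemma disc_agmon {τ : ℝ} (hτ : 0 < τ) {M : ℕ} (s : ℕ → X)
    (h0 : ∑ n ∈ Finset.range (M + 1), s n = 0) {n : ℕ} (hn : n ≤ M) :
    ‖s n‖^2 ≤ cA^2 * (seqNorm0 τ 0 M s * seqNorm0 τ 1 M (Dq τ s)) := by
  have hdiff : ∀ k ≤ M, _ := fun k hk => disc_diff hτ s hn hk
  set S := seqNorm0 τ 0 M s with hS
  set d := seqNorm0 τ 1 M (Dq τ s) with hd
  have hS0 : 0 ≤ S := seq_nonneg _ _ _ _
  have hd0 : 0 ≤ d := seq_nonneg _ _ _ _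
  have hS2 : S^2 = _ := seq0_sq hτ M s
  have hd2 : d^2 = _ := seq1_sq hτ M s
  set Q := ∑ i ∈ Finset.range (M+1), ‖s i‖^2 with hQ
  have hQ0 : 0 ≤ Q := Finset.sum_nonneg fun _ _ => by positivity
  have hpair : ∀ p ≤ M, ∀ q ≤ M, ‖s p - s q‖^2 ≤ M * (τ * d^2) := by
    intro p hp q hq
    have h1 := tele s hp hq
    have h2 := sq_sum_le_card_mul_sum_sq (s := Finset.range M) (f := fun i => ‖s (i+1) - s i‖)
    rw [Finset.card_range] at h2
    have h3 : ∑ i ∈ Finset.range M, ‖s (i+1) - s i‖^2 = τ * d^2 := by rw [hd2]; field_simp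
    rw [h3] at h2
    exact (pow_le_pow_left₀ (norm_nonneg _) h1 2).trans h2
  have hp1 : ∀ p ≤ M, Q + ((M+1:ℕ):ℝ) * ‖s p‖^2 ≤ ((M+1:ℕ):ℝ) * (M * (τ * d^2)) := by
    intro p hp
    have h1 := sum_sub_sq s (M+1) (s p)
    rw [h0, inner_zero_left] at h1
    have h2 : ∑ k ∈ Finset.range (M+1), ‖s k - s p‖^2 ≤ ∑ k ∈ Finset.range (M+1), M * (τ * d^2) :=
      Finset.sum_le_sum fun k hk => hpair k (by simpa [Nat.lt_succ_iff] using hk) p hp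
    rw [Finset.sum_const, Finset.card_range, nsmul_eq_mul] at h2
    linarith
  have hL : (0:ℝ) < ((M+1:ℕ):ℝ) := by positivity
  have hML : (M:ℝ) ≤ ((M+1:ℕ):ℝ) := by push_cast; linarith
  have hp2 : 2 * Q ≤ ((M+1:ℕ):ℝ) * (M * (τ * d^2)) := by
    have h2 := Finset.sum_le_sum fun k (hk : k ∈ Finset.range (M+1)) =>
      hp1 k (by simpa [Nat.lt_succ_iff] using hk)
    rw [Finset.sum_add_distrib, ← Finset.mul_sum, Finset.sum_const, Finset.sum_const,
      Finset.card_range, nsmul_eq_mul, nsmul_eq_mul, ← hQ] at h2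
    refine le_of_mul_le_mul_left ?_ hL
    linarith
  set L : ℝ := ((M+1:ℕ):ℝ)
  have hmean : L * (‖s n‖^2 - 2 * (d * S)) ≤ Q := by
    have h2 := Finset.sum_le_sum fun k (hk : k ∈ Finset.range (M+1)) =>
      (show ‖s n‖^2 - 2 * (d * S) ≤ ‖s k‖^2 by
        have := hdiff k (by simpa [Nat.lt_succ_iff] using hk); linarith)
    rw [Finset.sum_const, Finset.card_range, nsmul_eq_mul] at h2
    exact h2
  have hQS : Q ≤ L * (Real.sqrt 2 / 2 * (S * d)) := by
    refine (le_abs_self _).trans (abs_le_of_sq_le_sq ?_ (by positivity))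
    have h2 : Real.sqrt 2 ^ 2 = 2 := Real.sq_sqrt (by norm_num)
    have e : (L * (Real.sqrt 2 / 2 * (S * d)))^2 = L^2 * (1/2) * (S^2 * d^2) := by
      calc _ = L^2 * (Real.sqrt 2 ^ 2 / 4) * (S^2 * d^2) := by ring
        _ = _ := by rw [h2]; ring
    rw [e, hS2]
    have h5 : L * (M * (τ * d^2)) ≤ L * (L * (τ * d^2)) := by gcongr
    have h6 : Q * (2 * Q) ≤ Q * (L * (L * (τ * d^2))) :=
      mul_le_mul_of_nonneg_left (hp2.trans h5) hQ0
    nlinarith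
  have hcA : cA^2 = 2 + Real.sqrt 2 / 2 := by unfold cA; rw [Real.sq_sqrt (by positivity)]
  have := le_of_mul_le_mul_left (hmean.trans hQS) hL
  rw [hcA]; linarith

lemma disc_triv {τ : ℝ} (hτ : 0 < τ) {M : ℕ} (s : ℕ → X) :
    τ * seqNorm0 τ 1 M (Dq τ s) ≤ 2 * seqNorm0 τ 0 M s := by
  have hS0 : 0 ≤ seqNorm0 τ 0 M s := seq_nonneg _ _ _ _
  refine (le_abs_self _).trans (abs_le_of_sq_le_sq ?_ (by positivity))
  rw [mul_pow, mul_pow, seq0_sq hτ, seq1_sq hτ]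
  have h1 : ∑ i ∈ Finset.range M, ‖s (i+1) - s i‖^2 ≤
      ∑ i ∈ Finset.range M, (2 * ‖s (i+1)‖^2 + 2 * ‖s i‖^2) := by
    refine Finset.sum_le_sum fun i _ => ?_
    have := norm_sub_le (s (i+1)) (s i)
    nlinarith [norm_nonneg (s (i+1) - s i), sq_nonneg (‖s (i+1)‖ - ‖s i‖)]
  rw [Finset.sum_add_distrib, ← Finset.mul_sum, ← Finset.mul_sum] at h1
  have a1 := Finset.sum_range_succ (fun i => ‖s i‖^2) M
  have a2 := Finset.sum_range_succ' (fun i => ‖s i‖^2) M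
  have e : τ^2 * (τ⁻¹ * ∑ i ∈ Finset.range M, ‖s (i+1) - s i‖^2) =
     τ * ∑ i ∈ Finset.range M, ‖s (i+1) - s i‖^2 := by field_simp
  rw [e]
  have := sq_nonneg ‖s 0‖
  have := sq_nonneg ‖s M‖
  calc _ ≤ τ * (4 * ∑ i ∈ Finset.range (M+1), ‖s i‖^2) := by gcongr; linarith
    _ = _ := by ring

lemma disc_mean {T τ : ℝ} (hT : 0 < T) {M : ℕ} (hM : 0 < M) (hτ : τ = T / M) (s : ℕ → X) {n : ℕ}
    (hn : n ≤ M) : ∃ x : ℝ, 0 ≤ x ∧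
    x^2 ≤ cA^2 * (seqNorm0 τ 0 M s * seqNorm0 τ 1 M (Dq τ s)) ∧
    ‖s n‖ ≤ x + seqNorm0 τ 0 M s / Real.sqrt T := by
  have hM' : (0:ℝ) < M := by exact_mod_cast hM
  have hτ0 : 0 < τ := by rw [hτ]; positivity
  have hL : (0:ℝ) < ((M+1:ℕ):ℝ) := by positivity
  set μ : X := ((M+1:ℕ):ℝ)⁻¹ • ∑ k ∈ Finset.range (M+1), s k with hμ
  have hsum : ∑ k ∈ Finset.range (M+1), s k = ((M+1:ℕ):ℝ) • μ := by
    rw [hμ, smul_inv_smul₀ hL.ne']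
  have hz : ∑ k ∈ Finset.range (M+1), (fun i => s i - μ) k = 0 := by
    rw [Finset.sum_sub_distrib, hsum, Finset.sum_const, Finset.card_range, ← Nat.cast_smul_eq_nsmul ℝ,
      sub_self]
  have hA := disc_agmon hτ0 (fun i => s i - μ) hz hn
  have hD : Dq τ (fun i => s i - μ) = Dq τ s := by
    funext i; simp [Dq]
  rw [hD] at hA
  have hS0 : 0 ≤ seqNorm0 τ 0 M s := seq_nonneg _ _ _ _
  have hd0 : 0 ≤ seqNorm0 τ 1 M (Dq τ s) := seq_nonneg _ _ _ _
  have hsq := sum_sub_sq s (M+1) μ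
  rw [hsum, inner_smul_left, real_inner_self_eq_norm_sq] at hsq
  simp only [conj_trivial] at hsq
  have hSS : seqNorm0 τ 0 M (fun i => s i - μ) ≤ seqNorm0 τ 0 M s := by
    refine (le_abs_self _).trans (abs_le_of_sq_le_sq ?_ hS0)
    rw [seq0_sq hτ0, seq0_sq hτ0]
    gcongr ?_ * ?_
    have : 0 ≤ ((M+1:ℕ):ℝ) * ‖μ‖^2 := by positivity
    linarith
  refine ⟨‖s n - μ‖, norm_nonneg _, hA.trans (by gcongr), ?_⟩
  have hμS : ‖μ‖ ≤ seqNorm0 τ 0 M s / Real.sqrt T := by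
    rw [le_div_iff₀ (by positivity)]
    refine (le_abs_self _).trans (abs_le_of_sq_le_sq ?_ hS0)
    rw [mul_pow, Real.sq_sqrt hT.le, seq0_sq hτ0]
    have h1 : 0 ≤ ∑ k ∈ Finset.range (M+1), ‖s k - μ‖^2 := Finset.sum_nonneg fun _ _ => by positivity
    have h2 : ((M+1:ℕ):ℝ) * ‖μ‖^2 ≤ ∑ k ∈ Finset.range (M+1), ‖s k‖^2 := by linarith
    have hTM : T = τ * M := by rw [hτ]; field_simp
    calc ‖μ‖^2 * T = τ * (M * ‖μ‖^2) := by rw [hTM]; ring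
      _ ≤ τ * (((M+1:ℕ):ℝ) * ‖μ‖^2) := by gcongr; omega
      _ ≤ _ := by gcongr
  have := norm_le_norm_sub_add (s n) μ
  linarith
end

section
variable {X : Type*} [NormedAddCommGroup X] [InnerProductSpace ℝ X] [CompleteSpace X]

lemma cell_bound {a b : ℝ} {g g' : ℝ → X} (hg : ContinuousOn g (Set.Icc a b))
    (hg' : ContinuousOn g' (Set.Icc a b)) (hd : ∀ t ∈ Set.Ioo a b, HasDerivAt g (g' t) t)
    {p : ℝ} (hap : a ≤ p) (hpb : p ≤ b) :
    ‖g b - g p‖^2 ≤ (b - a) * ∫ t in a..b, ‖g' t‖^2 := by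
  have h1 := aux_ftc hg hg' hd hap hpb le_rfl
  have h2 := aux_cs (hap.trans hpb) (u := fun _ => 1) continuousOn_const hg'.norm
  simp only [one_mul, one_pow, intervalIntegral.integral_const, smul_eq_mul, mul_one] at h2
  exact (pow_le_pow_left₀ (norm_nonneg _) h1 2).trans h2

lemma discretize {T τ : ℝ} (hT : 0 < T) {M : ℕ} (hM : 0 < M) (hτ : τ = T / M) {f f' : ℝ → X}
    (hf : ContinuousOn f (Set.Icc 0 T)) (hf' : ContinuousOn f' (Set.Icc 0 T))
    (hd : ∀ t ∈ Set.Ioo 0 T, HasDerivAt f (f' t) t) {s : ℕ → X}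
    (hs : s = fun n : ℕ => f ((n : ℝ) * τ)) :
    seqNorm0 τ 1 M (Dq τ s) ≤ LN T f' ∧
    LN T f ^ 2 ≤ 2 * seqNorm0 τ 0 M s ^ 2 + 2 * (τ * LN T f')^2 := by
  have hM' : (0:ℝ) < M := by exact_mod_cast hM
  have hτ0 : 0 < τ := by rw [hτ]; positivity
  have hTM : (M:ℝ) * τ = T := by rw [hτ]; field_simp
  have hsub : ∀ i < M, Set.Icc ((i:ℝ) * τ) (((i+1:ℕ):ℝ) * τ) ⊆ Set.Icc 0 T := by
    intro i hi
    apply Set.Icc_subset_Icc (by positivity)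
    rw [← hTM]
    gcongr; omega
  have hle : ∀ i : ℕ, (i:ℝ) * τ ≤ ((i+1:ℕ):ℝ) * τ := by
    intro i; gcongr; omega
  have hlen : ∀ i : ℕ, ((i+1:ℕ):ℝ) * τ - (i:ℝ) * τ = τ := by intro i; push_cast; ring
  have hadd : ∀ g : ℝ → X, ContinuousOn g (Set.Icc 0 T) →
      ∑ i ∈ Finset.range M, ∫ t in ((i:ℝ)*τ)..(((i+1:ℕ):ℝ)*τ), ‖g t‖^2 = LN T g ^2 := by
    intro g hg
    rw [intervalIntegral.sum_integral_adjacent_intervals (a := fun i : ℕ => (i:ℝ)*τ)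
      (f := fun t => ‖g t‖^2), LN_sq hT.le]
    · simp [hTM]
    · intro k hk
      exact ContinuousOn.intervalIntegrable_of_Icc (hle k) ((hg.mono (hsub k hk)).norm.pow 2)
  have hcell : ∀ i < M, ∀ p ∈ Set.Icc ((i:ℝ) * τ) (((i+1:ℕ):ℝ) * τ),
      ‖s (i+1) - f p‖^2 ≤ τ * ∫ t in ((i:ℝ)*τ)..(((i+1:ℕ):ℝ)*τ), ‖f' t‖^2 := by
    intro i hi p hp
    have h1 := cell_bound (hf.mono (hsub i hi)) (hf'.mono (hsub i hi)) (fun t ht => hd t ?_) hp.1 hp.2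
    · rw [hlen] at h1
      rw [hs]; exact h1
    · have h0 := (hsub i hi) (Set.left_mem_Icc.2 (hle i))
      have h1 := (hsub i hi) (Set.right_mem_Icc.2 (hle i))
      exact ⟨h0.1.trans_lt ht.1, ht.2.trans_le h1.2⟩
  constructor
  · refine (le_abs_self _).trans (abs_le_of_sq_le_sq ?_ (LN_nonneg _ _))
    rw [seq1_sq hτ0, ← hadd f' hf', Finset.mul_sum]
    refine Finset.sum_le_sum fun i hi => ?_
    have h1 := hcell i (Finset.mem_range.1 hi) ((i:ℝ)*τ) (Set.left_mem_Icc.2 (hle i))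
    rw [inv_mul_le_iff₀ hτ0]
    have e : s i = f ((i:ℝ)*τ) := by rw [hs]
    rw [e]; exact h1
  · rw [← hadd f hf, mul_pow, ← hadd f' hf', seq0_sq hτ0]
    have h1 : ∀ i ∈ Finset.range M, (∫ t in ((i:ℝ)*τ)..(((i+1:ℕ):ℝ)*τ), ‖f t‖^2) ≤
        2 * τ * ‖s (i+1)‖^2 + 2 * τ^2 * ∫ t in ((i:ℝ)*τ)..(((i+1:ℕ):ℝ)*τ), ‖f' t‖^2 := by
      intro i hi
      have hi := Finset.mem_range.1 hi
      set J := ∫ t in ((i:ℝ)*τ)..(((i+1:ℕ):ℝ)*τ), ‖f' t‖^2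
      have h2 : ∀ p ∈ Set.Icc ((i:ℝ) * τ) (((i+1:ℕ):ℝ) * τ),
          ‖f p‖^2 ≤ 2 * ‖s (i+1)‖^2 + 2 * (τ * J) := by
        intro p hp
        have h3 := hcell i hi p hp
        have h4 := norm_sub_le (s (i+1)) (s (i+1) - f p)
        rw [sub_sub_cancel] at h4
        nlinarith [norm_nonneg (f p), sq_nonneg (‖s (i+1)‖ - ‖s (i+1) - f p‖)]
      have h5 := intervalIntegral.integral_mono_on (hle i) (μ := MeasureTheory.volume)
        (ContinuousOn.intervalIntegrable_of_Icc (hle i) ((hf.mono (hsub i hi)).norm.pow 2))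
        intervalIntegrable_const h2
      rw [intervalIntegral.integral_const, hlen, smul_eq_mul] at h5
      refine h5.trans (le_of_eq ?_)
      ring
    refine (Finset.sum_le_sum h1).trans ?_
    rw [Finset.sum_add_distrib, ← Finset.mul_sum, ← Finset.mul_sum, Finset.sum_range_succ' _ M]
    have : 0 ≤ τ * ‖s 0‖^2 := by positivity
    linarith

/-- Weighted Sobolev quantities. -/
noncomputable def EE (T : ℝ) (g : ℕ → ℝ → X) : ℕ → ℝ
  | 0 => LN T (g 0)
  | (k+1) => Real.sqrt (∑ j ∈ Finset.Icc 1 (k+1), LN T (g j)^2 / T^(2*(k+1-j)))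

lemma EE_nonneg (T : ℝ) (g : ℕ → ℝ → X) (k : ℕ) : 0 ≤ EE T g k := by
  cases k
  · exact LN_nonneg _ _
  · exact Real.sqrt_nonneg _

lemma EE_succ_sq {T : ℝ} (hT : 0 < T) (g : ℕ → ℝ → X) (k : ℕ) :
    EE T g (k+1)^2 = ∑ j ∈ Finset.Icc 1 (k+1), LN T (g j)^2 / T^(2*(k+1-j)) := by
  unfold EE
  exact Real.sq_sqrt (Finset.sum_nonneg fun _ _ => by positivity)

lemma EE_one {T : ℝ} (g : ℕ → ℝ → X) : EE T g 1 = LN T (g 1) := by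
  simp [EE, Real.sqrt_sq (LN_nonneg T (g 1))]

lemma EE_rec {T : ℝ} (hT : 0 < T) (g : ℕ → ℝ → X) (k : ℕ) :
    EE T g (k+2)^2 = LN T (g (k+2))^2 + (EE T g (k+1) / T)^2 := by
  rw [div_pow, EE_succ_sq hT, EE_succ_sq hT, Finset.sum_Icc_succ_top (by omega), Finset.sum_div]
  simp only [Nat.sub_self, mul_zero, pow_zero, div_one]
  rw [add_comm]
  congr 1
  refine Finset.sum_congr rfl fun j hj => ?_
  have hj := (Finset.mem_Icc.1 hj).2
  rw [show 2 * (k+1+1-j) = 2 * (k+1-j) + 2 by omega, pow_add, div_div]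

lemma EE_LN {T : ℝ} (hT : 0 < T) (g : ℕ → ℝ → X) (k : ℕ) : LN T (g k) ≤ EE T g k := by
  match k with
  | 0 => exact le_rfl
  | 1 => rw [EE_one]
  | k+2 =>
    refine (le_abs_self _).trans (abs_le_of_sq_le_sq ?_ (EE_nonneg _ _ _))
    rw [EE_rec hT]
    have := sq_nonneg (EE T g (k+1) / T)
    linarith

lemma EE_mono {T : ℝ} (hT : 0 < T) (g : ℕ → ℝ → X) (k : ℕ) : EE T g (k+1) / T ≤ EE T g (k+2) := by
  refine (le_abs_self _).trans (abs_le_of_sq_le_sq ?_ (EE_nonneg _ _ _))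
  rw [EE_rec hT]
  have := sq_nonneg (LN T (g (k+2)))
  linarith

lemma EE_conv {T : ℝ} (hT : 0 < T) {g : ℕ → ℝ → X} {m : ℕ}
    (hc : ∀ k ≤ m, ContinuousOn (g k) (Set.Icc 0 T))
    (hd : ∀ k < m, ∀ t ∈ Set.Ioo 0 T, HasDerivAt (g k) (g (k+1) t) t) :
    ∀ k, k + 2 ≤ m → EE T g (k+1) ^ 2 ≤ (15/2:ℝ)^2 * (EE T g k * EE T g (k+2)) := by
  intro k hk
  have h3 := aux_three hT (hc k (by omega)) (hc (k+1) (by omega)) (hc (k+2) (by omega))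
    (hd k (by omega)) (hd (k+1) (by omega))
  have e0 := EE_nonneg T g k
  have e2 := EE_nonneg T g (k+2)
  have a0 := EE_LN hT g k
  have a1 := EE_LN hT g (k+1)
  have a2 := EE_LN hT g (k+2)
  have mo := EE_mono hT g k
  have h4 : LN T (g (k+1)) / T ≤ EE T g (k+2) := le_trans (by gcongr) mo
  have h5 : LN T (g (k+1)) ^ 2 ≤ 52 * (EE T g k * EE T g (k+2)) := by
    refine h3.trans ?_
    have := LN_nonneg T (g k)
    have := LN_nonneg T (g (k+1))
    have := LN_nonneg T (g (k+2))
    calc _ ≤ 26 * EE T g k * (EE T g (k+2) + EE T g (k+2)) := by gcongr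
      _ = _ := by ring
  have h6 : EE T g (k+1) ^ 2 ≤ LN T (g (k+1))^2 + EE T g k * EE T g (k+2) := by
    cases k with
    | zero => rw [zero_add, EE_one]; have := mul_nonneg e0 e2; simp only [zero_add] at *; linarith
    | succ k =>
      rw [EE_rec hT]
      have m1 := EE_mono hT g k
      have : (EE T g (k+1) / T)^2 ≤ EE T g (k+1) * EE T g (k+1+2) := by
        calc (EE T g (k+1) / T)^2 = EE T g (k+1) * (EE T g (k+1) / T / T) := by ring
          _ ≤ EE T g (k+1) * (EE T g (k+1+1) / T) := by gcongr
          _ ≤ _ := by gcongr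
      linarith
  nlinarith [mul_nonneg e0 e2]
end

/-- Combination in power form. -/
lemma combine {d S α N τ L e0 : ℝ} {k : ℕ} (hd0 : 0 ≤ d) (hS : 0 ≤ S) (hα : 0 ≤ α) (hN : 0 ≤ N)
    (hτ : 0 < τ) (hL : 0 ≤ L) (he0 : 0 ≤ e0)
    (h1 : d ≤ α) (h2 : τ * d ≤ 2 * S) (h3 : e0^2 ≤ 2 * S^2 + 2 * (τ * α)^2)
    (h4 : α^(k+1) ≤ L * (e0^k * N)) : d^(k+1) ≤ 4^(k+1) * (2^k * L * S^k * N) := by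
  rcases le_or_gt (τ * α) S with hc | hc
  · have h5 : e0 ≤ 2 * S := by
      refine (le_abs_self _).trans (abs_le_of_sq_le_sq ?_ (by positivity))
      have : (τ * α)^2 ≤ S^2 := by gcongr
      nlinarith
    calc d^(k+1) ≤ α^(k+1) := by gcongr
      _ ≤ L * (e0^k * N) := h4
      _ ≤ L * ((2*S)^k * N) := by gcongr
      _ = 1 * (2^k * L * S^k * N) := by rw [mul_pow]; ring
      _ ≤ _ := by gcongr; exact one_le_pow₀ (by norm_num)
  · have hα0 : 0 < α := by
      rcases hα.eq_or_lt with h | h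
      · rw [← h] at hc; simp at hc; linarith
      · exact h
    have h5 : e0 ≤ 2 * (τ * α) := by
      refine (le_abs_self _).trans (abs_le_of_sq_le_sq ?_ (by positivity))
      have : S^2 ≤ (τ * α)^2 := by gcongr
      nlinarith
    have h6 : α ≤ L * (2^k * τ^k * N) := by
      refine le_of_mul_le_mul_left ?_ (pow_pos hα0 k)
      calc α^k * α = α^(k+1) := by ring
        _ ≤ L * (e0^k * N) := h4
        _ ≤ L * ((2*(τ*α))^k * N) := by gcongr
        _ = _ := by rw [mul_pow, mul_pow]; ring
    refine le_of_mul_le_mul_left ?_ (pow_pos hτ (k+1))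
    calc τ^(k+1) * d^(k+1) = (τ*d)^(k+1) := by rw [mul_pow]
      _ ≤ (2*S)^(k+1) := by gcongr
      _ = 2^(k+1) * S^k * S := by ring
      _ ≤ 2^(k+1) * S^k * (τ * α) := by gcongr
      _ ≤ 2^(k+1) * S^k * (τ * (L * (2^k * τ^k * N))) := by gcongr
      _ = 2^(k+1) * (τ^(k+1) * (2^k * L * S^k * N)) := by ring
      _ ≤ 4^(k+1) * (τ^(k+1) * (2^k * L * S^k * N)) := by gcongr; norm_num
      _ = _ := by ring

lemma root_form {d S N c : ℝ} {m : ℕ} (hm : 1 ≤ m) (hS : 0 ≤ S) (hN : 0 ≤ N)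
    (hc : (15/2:ℝ)^(m-1) ≤ c)
    (h : d^m ≤ 4^m * (2^(m-1) * (15/2:ℝ)^((m-1)*m) * S^(m-1) * N)) :
    d ≤ 4 * 2 ^ (((m:ℝ)-1)/(m:ℝ)) * c * S ^ (((m:ℝ)-1)/(m:ℝ)) * N ^ (1/(m:ℝ)) := by
  have hm0 : (m:ℝ) ≠ 0 := by positivity
  have hc0 : 0 ≤ c := le_trans (by positivity) hc
  have hp : ∀ x : ℝ, 0 ≤ x → (x ^ (((m:ℝ)-1)/(m:ℝ)))^m = x^(m-1) := by
    intro x hx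
    rw [← Real.rpow_natCast, ← Real.rpow_mul hx, div_mul_cancel₀ _ hm0, ← Real.rpow_natCast,
      Nat.cast_sub hm, Nat.cast_one]
  have hq : (N ^ (1/(m:ℝ)))^m = N := by
    rw [← Real.rpow_natCast, ← Real.rpow_mul hN, div_mul_cancel₀ _ hm0, Real.rpow_one]
  refine le_of_pow_le_pow_left₀ (n := m) (by omega) (by positivity) ?_
  rw [mul_pow, mul_pow, mul_pow, mul_pow, hp 2 (by norm_num), hp S hS, hq]
  refine h.trans ?_
  rw [pow_mul]
  calc _ ≤ (4:ℝ)^m * (2^(m-1) * c^m * S^(m-1) * N) := by gcongr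
    _ = _ := by ring

lemma final_form {x d S N c : ℝ} {m : ℕ} (hm : 1 ≤ m) (hS : 0 ≤ S) (hN : 0 ≤ N) (hc : 0 ≤ c)
    (hx : x^2 ≤ cA^2 * (S * d))
    (h : d ≤ 4 * 2 ^ (((m:ℝ)-1)/(m:ℝ)) * c * S ^ (((m:ℝ)-1)/(m:ℝ)) * N ^ (1/(m:ℝ))) :
    x ≤ 2 * 2 ^ (((m:ℝ)-1)/(2*(m:ℝ))) * cA * c ^ ((1:ℝ)/2) *
          S ^ (1 - 1/(2*(m:ℝ))) * N ^ (1/(2*(m:ℝ))) := by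
  have hm1 : (1:ℝ) ≤ m := by exact_mod_cast hm
  have hm0 : (m:ℝ) ≠ 0 := by positivity
  have hcA : 0 ≤ cA := Real.sqrt_nonneg _
  have sq : ∀ y : ℝ, 0 ≤ y → ∀ e : ℝ, (y^e)^2 = y^(e*2) := by
    intro y hy e
    rw [← Real.rpow_natCast, ← Real.rpow_mul hy]; norm_num
  refine (le_abs_self _).trans (abs_le_of_sq_le_sq ?_ (by positivity))
  rw [mul_pow, mul_pow, mul_pow, mul_pow, mul_pow, sq 2 (by norm_num), sq c hc, sq S hS, sq N hN]
  have e1 : ((m:ℝ)-1)/(2*(m:ℝ)) * 2 = ((m:ℝ)-1)/(m:ℝ) := by field_simp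
  have e2 : (1:ℝ)/2*2 = 1 := by norm_num
  have e3 : (1 - 1/(2*(m:ℝ)))*2 = 1 + ((m:ℝ)-1)/(m:ℝ) := by field_simp; ring
  have e4 : 1/(2*(m:ℝ))*2 = 1/(m:ℝ) := by field_simp
  have e5 : 0 ≤ ((m:ℝ)-1)/(m:ℝ) := div_nonneg (by linarith) (by linarith)
  rw [e1, e2, e3, e4, Real.rpow_one, Real.rpow_add_of_nonneg hS (by norm_num) e5, Real.rpow_one]
  refine hx.trans ?_
  calc cA^2 * (S * d) ≤ cA^2 * (S * (4 * 2 ^ (((m:ℝ)-1)/(m:ℝ)) * c * S ^ (((m:ℝ)-1)/(m:ℝ)) * N ^ (1/(m:ℝ)))) := by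
        gcongr
    _ = _ := by ring

/-- Theorem 4.10: bounds for the sequence of values `f(t_n)` of a function in
`H^m(0,T,X)`: an interpolation bound for the difference quotients and a
pointwise (Agmon-type) bound, whose last term can be dropped for zero-mean data. -/
theorem function_values_bounds
    {X : Type*} [NormedAddCommGroup X] [InnerProductSpace ℝ X] [CompleteSpace X]
    (T : ℝ) (hT : 0 < T) (M : ℕ) (hM : 0 < M) (τ : ℝ) (hτ : τ = T / M)
    (m : ℕ) (hm : 1 ≤ m) (hmM : m ≤ M)
    (f : ℝ → X) (hf : ContDiffOn ℝ (m : ℕ∞) f (Set.Icc 0 T))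
    (s : ℕ → X) (hs : s = fun n : ℕ => f ((n : ℝ) * τ))
    (N : ℝ)
    (hN : N = Real.sqrt (∑ k ∈ Finset.Icc 1 m,
        (∫ t in (0:ℝ)..T, ‖iteratedDerivWithin k f (Set.Icc 0 T) t‖^2) / T^(2*(m-k)))) :
    (seqNorm0 τ 1 M (Dq τ s) ≤
      4 * 2 ^ (((m:ℝ)-1)/(m:ℝ)) * cConst m *
        (seqNorm0 τ 0 M s) ^ (((m:ℝ)-1)/(m:ℝ)) * N ^ (1/(m:ℝ)))
    ∧ (∀ n ≤ M,
        ‖s n‖ ≤ 2 * 2 ^ (((m:ℝ)-1)/(2*(m:ℝ))) * cA * (cConst m) ^ ((1:ℝ)/2) *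
          (seqNorm0 τ 0 M s) ^ (1 - 1/(2*(m:ℝ))) * N ^ (1/(2*(m:ℝ)))
          + seqNorm0 τ 0 M s / Real.sqrt T)
    ∧ ((∑ n ∈ Finset.range (M + 1), s n = 0) →
        ∀ n ≤ M,
          ‖s n‖ ≤ 2 * 2 ^ (((m:ℝ)-1)/(2*(m:ℝ))) * cA * (cConst m) ^ ((1:ℝ)/2) *
            (seqNorm0 τ 0 M s) ^ (1 - 1/(2*(m:ℝ))) * N ^ (1/(2*(m:ℝ)))) := by

  have hM' : (0:ℝ) < M := by exact_mod_cast hM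
  have hτ0 : 0 < τ := by rw [hτ]; positivity
  set g : ℕ → ℝ → X := fun k => iteratedDerivWithin k f (Set.Icc 0 T) with hg
  have hu := uniqueDiffOn_Icc hT
  have hc : ∀ k ≤ m, ContinuousOn (g k) (Set.Icc 0 T) := fun k hk =>
    hf.continuousOn_iteratedDerivWithin (by exact_mod_cast hk) hu
  have hd : ∀ k < m, ∀ t ∈ Set.Ioo 0 T, HasDerivAt (g k) (g (k+1) t) t := by
    intro k hk t ht
    have h1 := hf.differentiableOn_iteratedDerivWithin (m := k) (by exact_mod_cast hk) hu t
      (Set.Ioo_subset_Icc_self ht)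
    have h2 := h1.hasDerivWithinAt
    rw [← iteratedDerivWithin_succ] at h2
    exact h2.hasDerivAt (Icc_mem_nhds ht.1 ht.2)
  have hg0 : g 0 = f := by simp [hg, iteratedDerivWithin_zero]
  have hEN : EE T g m = N := by
    obtain ⟨k, rfl⟩ : ∃ k, m = k + 1 := ⟨m - 1, by omega⟩
    rw [hN]
    simp only [EE, LN_sq hT.le]
    rfl
  have hQ := aux_Q (EE_nonneg T g) (by norm_num) (EE_conv hT hc hd) (m - 1) (by omega)
  rw [show m - 1 + 1 = m by omega, hEN, EE_one] at hQ
  have hdisc := discretize hT hM hτ (f := f) (f' := g 1) (by rw [← hg0]; exact hc 0 (by omega))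
    (hc 1 hm) (by have := hd 0 (by omega); rwa [hg0] at this) hs
  have hN0 : 0 ≤ N := by rw [← hEN]; exact EE_nonneg _ _ _
  have hS0 : 0 ≤ seqNorm0 τ 0 M s := seq_nonneg _ _ _ _
  have hE0 : EE T g 0 = LN T f := by simp only [EE, hg0]
  rw [hE0] at hQ
  have hcomb := combine (k := m - 1) (seq_nonneg τ 1 M (Dq τ s)) hS0 (LN_nonneg T (g 1)) hN0 hτ0
    (L := (15/2:ℝ)^((m-1)*m)) (by positivity) (LN_nonneg T f) hdisc.1 (disc_triv hτ0 s) hdisc.2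
    (by rw [show m - 1 + 1 = m by omega]; exact hQ)
  rw [show m - 1 + 1 = m by omega] at hcomb
  have hcc := cConst_ge m
  have hi := root_form hm hS0 hN0 hcc hcomb
  have hc0 : 0 ≤ cConst m := le_trans (by positivity) hcc
  refine ⟨hi, ?_, ?_⟩
  · intro n hn
    obtain ⟨x, hx0, hx, hxs⟩ := disc_mean hT hM hτ s hn
    have := final_form hm hS0 hN0 hc0 hx hi
    linarith
  · intro hz n hn
    exact final_form hm hS0 hN0 hc0 (disc_agmon hτ0 s hz hn) hi
end
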